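/- Let (k, ℓ) be a pair of normalized diagonal holomorphic kernels on a domain Ω ⊆ ℂ^𝗀 with 0 ∈ Ω, and let (θ_a) be the master certificate associated with k. Then (k, ℓ), viewed as kernels on Ω, is a complete Pick pair if and only if the following two conditions hold: (a) for every x ∈ Ω the series Σ_{a≠0} θ_a·|x^a|² converges and its sum is strictly less than 1; and (b) the function g(z,w) = ℓ(z,w)·(1 − Σ_{a≠0} θ_a·z^a·conj(w^a)) is a positive kernel on Ω. -/

import Mathlib

open Matrix
open scoped ComplexOrder

noncomputable section

/-- `k` is a positive (semi-definite) kernel on `X`: every Gram sum is a nonnegative real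
(using the partial order on `ℂ`, so `0 ≤ w` means `w` is real and nonnegative). -/
def IsPosKernel {X : Type*} (k : X → X → ℂ) : Prop :=
  ∀ (n : ℕ) (z : Fin n → X) (c : Fin n → ℂ),
    0 ≤ ∑ i, ∑ j, (starRingEnd ℂ) (c i) * c j * k (z i) (z j)

/-- Positive semidefiniteness of the block matrix `[ℓ(z i, z j)·I − k(z i, z j)·W i (W j)ᴴ]`. -/
def PickBlockPSD {X : Type*} (k ℓ : X → X → ℂ) {n N : ℕ}
    (z : Fin n → X) (W : Fin n → Matrix (Fin N) (Fin N) ℂ) : Prop :=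
  ∀ u : Fin n → (Fin N → ℂ),
    0 ≤ ∑ i, ∑ j,
      star (u i) ⬝ᵥ ((ℓ (z i) (z j) • (1 : Matrix (Fin N) (Fin N) ℂ)
        - k (z i) (z j) • (W i * (W j)ᴴ)) *ᵥ u j)

/-- `Φ` is a contractive multiplier from `k` to `ℓ`. -/
def IsContractiveMultiplier {X : Type*} (k ℓ : X → X → ℂ) {N : ℕ}
    (Φ : X → Matrix (Fin N) (Fin N) ℂ) : Prop :=
  ∀ (n : ℕ) (z : Fin n → X), PickBlockPSD k ℓ z fun i => Φ (z i)

/-- `(k, ℓ)` is a complete Pick pair. -/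
def IsCompletePickPair {X : Type*} (k ℓ : X → X → ℂ) : Prop :=
  ∀ (n N : ℕ), 1 ≤ n → 1 ≤ N →
    ∀ (z : Fin n → X) (W : Fin n → Matrix (Fin N) (Fin N) ℂ),
      PickBlockPSD k ℓ z W →
      ∃ Φ : X → Matrix (Fin N) (Fin N) ℂ,
        IsContractiveMultiplier k ℓ Φ ∧ ∀ i, Φ (z i) = W i
open scoped Classical

/-- The monomial `z^a = ∏ i, (z i)^(a i)` for a multi-index `a ∈ ℕ^𝗀`. -/
def mpow {g : ℕ} (z : Fin g → ℂ) (a : Fin g → ℕ) : ℂ := ∏ i, z i ^ a i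

/-- The diagonal kernel `k(z,w) = Σ_a k_a · z^a · conj (w^a)` with coefficients `kc`. -/
def diagKer {g : ℕ} (kc : (Fin g → ℕ) → ℝ) (z w : Fin g → ℂ) : ℂ :=
  ∑' a : Fin g → ℕ, (kc a : ℂ) * mpow z a * (starRingEnd ℂ) (mpow w a)

/-- `kc` is the coefficient family of a normalized diagonal holomorphic kernel on `Ω`:
`k_0 = 1`, `k_a > 0`, and `Σ_a k_a·|x^a|² < ∞` for every `x ∈ Ω`. -/
def IsNormalizedDiag {g : ℕ} (Ω : Set (Fin g → ℂ)) (kc : (Fin g → ℕ) → ℝ) : Prop :=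
  kc 0 = 1 ∧ (∀ a, 0 < kc a) ∧
    ∀ x ∈ Ω, Summable fun a : Fin g → ℕ => kc a * ‖mpow x a‖ ^ 2

/-- `θ` is the master certificate associated with the coefficient family `kc`: `θ_0 = 0`,
`θ_b = k_b` when `|b| = 1`, and `θ_b = max (0, k_b − Σ_{0 < w < b} θ_w k_{b−w})` when
`|b| ≥ 2`. -/
def IsMasterCert {g : ℕ} (kc θ : (Fin g → ℕ) → ℝ) : Prop :=
  θ 0 = 0 ∧
  (∀ b : Fin g → ℕ, (∑ i, b i) = 1 → θ b = kc b) ∧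
  ∀ b : Fin g → ℕ, 2 ≤ ∑ i, b i →
    θ b = max 0 (kc b -
      ∑ w ∈ Finset.Icc (0 : Fin g → ℕ) b,
        if w ≠ 0 ∧ w ≠ b then θ w * kc (b - w) else 0)

lemma isPosKernel_fintype {X : Type*} {k : X → X → ℂ} (hk : IsPosKernel k) {ι : Type*} [Fintype ι]
    (z : ι → X) (c : ι → ℂ) :
    0 ≤ ∑ i, ∑ j, (starRingEnd ℂ) (c i) * c j * k (z i) (z j) := by
  have e := (Fintype.equivFin ι)
  have := hk (Fintype.card ι) (z ∘ e.symm) (c ∘ e.symm)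
  rw [← e.symm.sum_comp]
  simp_rw [← e.symm.sum_comp (fun j => (starRingEnd ℂ) (c _) * c j * k (z _) (z j))]
  exact this

lemma IsPosKernel.herm {X : Type*} {k : X → X → ℂ} (hk : IsPosKernel k) (x y : X) :
    (starRingEnd ℂ) (k y x) = k x y := by
  have h1 := hk 1 ![x] ![1]
  have h2 := hk 1 ![y] ![1]
  have h3 := hk 2 ![x, y] ![1, 1]
  have h4 := hk 2 ![x, y] ![1, Complex.I]
  simp [Fin.sum_univ_two, Complex.nonneg_iff] at h1 h2 h3 h4
  apply Complex.ext
  · simp; linarith [h4.2]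
  · simp; linarith [h3.2]

lemma IsPosKernel.posSemidef {X : Type*} {k : X → X → ℂ} (hk : IsPosKernel k) :
    (Matrix.of k).PosSemidef := by
  refine ⟨?_, ?_⟩
  · ext x y
    simpa [Matrix.conjTranspose_apply] using hk.herm x y
  · intro x
    have := isPosKernel_fintype hk (ι := x.support) (fun i => i) (fun i => x i)
    simp only [Finsupp.sum]
    rw [← Finset.sum_coe_sort]
    simp_rw [← Finset.sum_coe_sort x.support (fun j => star (x _) * (Matrix.of k) _ j * x j)]
    refine this.trans_eq ?_
    refine Finset.sum_congr rfl fun i _ => Finset.sum_congr rfl fun j _ => ?_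
    simp; ring

lemma posSemidef_fintype {X : Type*} {M : Matrix X X ℂ} (hM : M.PosSemidef) {ι : Type*} [Fintype ι]
    (z : ι → X) (c : ι → ℂ) :
    0 ≤ ∑ i, ∑ j, (starRingEnd ℂ) (c i) * c j * M (z i) (z j) := by
  have := (hM.submatrix z).dotProduct_mulVec_nonneg c
  refine this.trans_eq ?_
  simp only [dotProduct, mulVec, Finset.mul_sum]
  refine Finset.sum_congr rfl fun i _ => Finset.sum_congr rfl fun j _ => ?_
  simp; ring

lemma PosSemidef.isPosKernel {X : Type*} {M : Matrix X X ℂ} (hM : M.PosSemidef) :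
    IsPosKernel M := fun _ z c => posSemidef_fintype hM z c

lemma exists_feature {X : Type} (M : Matrix X X ℂ) (hM : M.PosSemidef) :
    ∃ (H : Type) (_ : NormedAddCommGroup H) (_ : InnerProductSpace ℂ H) (G : X → H),
      ∀ x y, inner ℂ (G x) (G y) = M x y := by
  let K : Matrix X X (ℂ →L[ℂ] ℂ) := Matrix.of fun x y => M x y • (1 : ℂ →L[ℂ] ℂ)
  have hK : K.PosSemidef := by
    have t := (RKHS.posSemidef_tfae (K := K)).out 0 2
    refine t.mpr ⟨?_, ?_⟩
    · ext x y
      simp [K, Matrix.conjTranspose_apply, star_smul]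
      have := congrFun (congrFun hM.1 x) y
      simpa [Matrix.conjTranspose_apply] using this
    · intro v
      have := hM.2 v
      rw [Complex.nonneg_iff] at this
      refine this.1.trans_eq ?_
      simp only [K, Finsupp.sum]
      rw [Finset.sum_comm, ← Complex.conj_re]
      simp [mul_comm, mul_assoc, mul_left_comm]
  have : Fact K.PosSemidef := ⟨hK⟩
  refine ⟨RKHS.OfKernel K, inferInstance, inferInstance,
    fun x => RKHS.kerFun (RKHS.OfKernel K) x 1, fun x y => ?_⟩
  rw [RKHS.kerFun_inner, RKHS.kerFun_apply, RKHS.OfKernel.kernel_ofKernel]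
  simp [K]

lemma form_inner {H : Type*} [NormedAddCommGroup H] [InnerProductSpace ℂ H] {ι : Type*} [Fintype ι]
    (a : ι → H) (c : ι → ℂ) :
    ∑ i, ∑ j, (starRingEnd ℂ) (c i) * c j * inner ℂ (a i) (a j)
      = ((‖∑ i, c i • a i‖ ^ 2 : ℝ) : ℂ) := by
  have := inner_self_eq_norm_sq_to_K (𝕜 := ℂ) (∑ i, c i • a i)
  rw [sum_inner] at this
  simp_rw [inner_sum, inner_smul_left, inner_smul_right] at this
  push_cast
  refine Eq.trans ?_ this
  refine Finset.sum_congr rfl fun i _ => Finset.sum_congr rfl fun j _ => ?_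
  ring

lemma exists_contraction {A B : Type*} [NormedAddCommGroup A] [InnerProductSpace ℂ A]
    [NormedAddCommGroup B] [InnerProductSpace ℂ B] {Q : Type*} [Fintype Q] (α : Q → A) (β : Q → B)
    (h : ∀ q q', inner ℂ (α q) (α q') = inner ℂ (β q) (β q')) :
    ∃ L : A →ₗ[ℂ] B, (∀ v, ‖L v‖ ≤ ‖v‖) ∧ ∀ q, L (α q) = β q := by
  let a : (Q → ℂ) →ₗ[ℂ] A := Fintype.linearCombination ℂ α
  let b : (Q → ℂ) →ₗ[ℂ] B := Fintype.linearCombination ℂ β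
  have hn : ∀ c, ‖a c‖ = ‖b c‖ := by
    intro c
    have h1 := form_inner α c
    have h2 := form_inner β c
    simp_rw [h] at h1
    rw [h1] at h2
    have h3 : ‖∑ i, c i • α i‖ ^ 2 = ‖∑ i, c i • β i‖ ^ 2 := by exact_mod_cast h2
    simp only [a, b, Fintype.linearCombination_apply]
    exact (sq_eq_sq₀ (norm_nonneg _) (norm_nonneg _)).1 h3
  have hker : LinearMap.ker a.rangeRestrict ≤ LinearMap.ker b := by
    intro c hc
    rw [LinearMap.ker_rangeRestrict] at hc
    rw [LinearMap.mem_ker] at hc ⊢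
    have := hn c
    rw [hc, norm_zero] at this
    exact norm_eq_zero.1 this.symm
  obtain ⟨r, hr⟩ := LinearMap.exists_rightInverse_of_surjective a.rangeRestrict
    (LinearMap.range_rangeRestrict a)
  have hL0 : ∀ c, b (r (a.rangeRestrict c)) = b c := by
    intro c
    have : r (a.rangeRestrict c) - c ∈ LinearMap.ker b := by
      apply hker
      rw [LinearMap.mem_ker, map_sub]
      have := LinearMap.congr_fun hr (a.rangeRestrict c)
      simp only [LinearMap.comp_apply, LinearMap.id_apply] at this
      rw [this, sub_self]
    rw [LinearMap.mem_ker, map_sub, sub_eq_zero] at this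
    exact this
  have : FiniteDimensional ℂ (LinearMap.range a) := inferInstance
  refine ⟨b ∘ₗ r ∘ₗ ((LinearMap.range a).orthogonalProjection : A →ₗ[ℂ] LinearMap.range a), ?_, ?_⟩
  · intro v
    obtain ⟨c, hc⟩ := LinearMap.surjective_rangeRestrict a ((LinearMap.range a).orthogonalProjection v)
    simp only [LinearMap.comp_apply, ContinuousLinearMap.coe_coe]
    rw [← hc, hL0, ← hn]
    have h1 : ‖a c‖ = ‖a.rangeRestrict c‖ := rfl
    rw [h1, hc]
    exact Submodule.norm_orthogonalProjection_apply_le _ v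
  · intro q
    have h1 : a (Pi.single q 1) = α q := by
      simp [a, Fintype.linearCombination_apply_single]
    have h2 : b (Pi.single q 1) = β q := by
      simp [b, Fintype.linearCombination_apply_single]
    simp only [LinearMap.comp_apply, ContinuousLinearMap.coe_coe]
    have h3 : (LinearMap.range a).orthogonalProjection (α q) = a.rangeRestrict (Pi.single q 1) := by
      rw [← h1]
      exact Submodule.orthogonalProjection_mem_subspace_eq_self (a.rangeRestrict (Pi.single q 1))
    rw [h3, hL0, h2]

lemma posSemidef_of_form {Q : Type*} [Fintype Q] (M : Matrix Q Q ℂ)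
    (h : ∀ c : Q → ℂ, 0 ≤ ∑ i, ∑ j, (starRingEnd ℂ) (c i) * c j * M i j) : M.PosSemidef := by
  have h' : ∀ x : Q → ℂ, 0 ≤ star x ⬝ᵥ (M *ᵥ x) := by
    intro x
    refine (h x).trans_eq ?_
    simp only [dotProduct, mulVec, Finset.mul_sum]
    refine Finset.sum_congr rfl fun i _ => Finset.sum_congr rfl fun j _ => ?_
    simp; ring
  rw [← Matrix.isPositive_toEuclideanLin_iff, LinearMap.isPositive_iff_complex]
  intro x
  have h3 := h' (WithLp.ofLp x)
  have h4 : inner ℂ (Matrix.toEuclideanLin M x) x = star (star (WithLp.ofLp x) ⬝ᵥ (M *ᵥ (WithLp.ofLp x))) := by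
    rw [EuclideanSpace.inner_eq_star_dotProduct]
    rw [Matrix.star_dotProduct]
    simp [Matrix.toEuclideanLin, dotProduct_comm]
  rw [h4]
  rw [Complex.nonneg_iff] at h3
  refine ⟨?_, ?_⟩
  · apply Complex.ext <;> simp [← h3.2]
  · simpa using h3.1

lemma pick_form_eq {n N : ℕ} (l k : Fin n → Fin n → ℂ) (W : Fin n → Matrix (Fin N) (Fin N) ℂ)
    (u : Fin n → Fin N → ℂ) :
    ∑ i, ∑ j, star (u i) ⬝ᵥ ((l i j • (1 : Matrix (Fin N) (Fin N) ℂ)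
        - k i j • (W i * (W j)ᴴ)) *ᵥ u j)
    = ∑ p : Fin n × Fin N, ∑ q : Fin n × Fin N, (starRingEnd ℂ) (u p.1 p.2) * u q.1 q.2 *
        (l p.1 q.1 * (if p.2 = q.2 then 1 else 0) - k p.1 q.1 * (W p.1 * (W q.1)ᴴ) p.2 q.2) := by
  simp_rw [Fintype.sum_prod_type]
  refine Finset.sum_congr rfl fun i _ => ?_
  rw [Finset.sum_comm]
  refine Finset.sum_congr rfl fun j _ => ?_
  simp only [dotProduct, mulVec, Finset.mul_sum]
  refine Finset.sum_congr rfl fun r _ => Finset.sum_congr rfl fun t _ => ?_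
  simp [Matrix.one_apply]; ring

open scoped TensorProduct in
lemma aux_spaces {X R : Type} {Hg Hf Hθ E S : Type}
    [NormedAddCommGroup Hg] [InnerProductSpace ℂ Hg]
    [NormedAddCommGroup Hf] [InnerProductSpace ℂ Hf]
    [NormedAddCommGroup Hθ] [InnerProductSpace ℂ Hθ]
    [NormedAddCommGroup E] [InnerProductSpace ℂ E] [FiniteDimensional ℂ E]
    [NormedAddCommGroup S] [InnerProductSpace ℂ S] [FiniteDimensional ℂ S]
    (G : X → Hg) (ψ : X → Hf) (τ : X → Hθ) (e : R → E) :
    ∃ (A B : Type) (_ : NormedAddCommGroup A) (_ : InnerProductSpace ℂ A)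
      (_ : NormedAddCommGroup B) (_ : InnerProductSpace ℂ B) (_ : FiniteDimensional ℂ B)
      (a : X → R → B → A) (J : X → B →ₗ[ℂ] A) (pr₁ : B → E) (pr₂ : B → S) (mk : E → S → B),
      (∀ u v, pr₁ (mk u v) = u) ∧ (∀ u v, pr₂ (mk u v) = v) ∧
      (∀ b b' : B, inner ℂ b b' = inner ℂ (pr₁ b) (pr₁ b') + inner ℂ (pr₂ b) (pr₂ b')) ∧
      (∀ x r b y t b', inner ℂ (a x r b) (a y t b') = inner ℂ (G x) (G y) * inner ℂ (e r) (e t)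
        + (inner ℂ (ψ x) (ψ y) * inner ℂ (pr₁ b) (pr₁ b')
        + inner ℂ (τ x) (τ y) * inner ℂ (pr₂ b) (pr₂ b'))) ∧
      (∀ b : B, ‖b‖ ^ 2 = ‖pr₁ b‖ ^ 2 + ‖pr₂ b‖ ^ 2) ∧
      (∀ x b, ‖J x b‖ ^ 2 = ‖ψ x‖ ^ 2 * ‖pr₁ b‖ ^ 2 + ‖τ x‖ ^ 2 * ‖pr₂ b‖ ^ 2) ∧
      (∀ x r b, a x r b = a x r 0 + J x b) := by
  refine ⟨WithLp 2 ((Hg ⊗[ℂ] E) × WithLp 2 ((Hf ⊗[ℂ] E) × (Hθ ⊗[ℂ] S))), WithLp 2 (E × S),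
    inferInstance, inferInstance, inferInstance, inferInstance, inferInstance,
    fun x r b => WithLp.toLp 2 (G x ⊗ₜ e r, WithLp.toLp 2 (ψ x ⊗ₜ b.fst, τ x ⊗ₜ b.snd)),
    fun x =>
    { toFun := fun b => WithLp.toLp 2 (0, WithLp.toLp 2 (ψ x ⊗ₜ b.fst, τ x ⊗ₜ b.snd))
      map_add' := fun b b' => by
        rw [← WithLp.toLp_add, Prod.mk_add_mk, ← WithLp.toLp_add, Prod.mk_add_mk]
        simp [TensorProduct.tmul_add]
        rfl
      map_smul' := fun c b => by
        rw [RingHom.id_apply, ← WithLp.toLp_smul, Prod.smul_mk, ← WithLp.toLp_smul, Prod.smul_mk]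
        simp [TensorProduct.tmul_smul]
        rfl },
    fun b => b.fst, fun b => b.snd, fun u v => WithLp.toLp 2 (u, v),
    fun u v => rfl, fun u v => rfl, ?_, ?_, ?_, ?_, ?_⟩
  · intro b b'
    rw [WithLp.prod_inner_apply]; rfl
  · intro x r b y t b'
    rw [WithLp.prod_inner_apply, WithLp.prod_inner_apply]
    simp only [TensorProduct.inner_tmul]
  · intro b
    rw [WithLp.prod_norm_sq_eq_of_L2]
  · intro x b
    simp only [LinearMap.coe_mk, AddHom.coe_mk]
    rw [WithLp.prod_norm_sq_eq_of_L2]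
    simp only [WithLp.prod_norm_sq_eq_of_L2]
    simp [mul_pow]
  · intro x r b
    simp only [LinearMap.coe_mk, AddHom.coe_mk]
    rw [← WithLp.toLp_add, Prod.mk_add_mk, ← WithLp.toLp_add, Prod.mk_add_mk]
    simp

theorem suff_abstract {X : Type} (k ℓ s f θ g : X → X → ℂ)
    (hs : (Matrix.of s).PosSemidef) (hf : (Matrix.of f).PosSemidef)
    (hθ : (Matrix.of θ).PosSemidef) (hg : (Matrix.of g).PosSemidef)
    (hsθ : ∀ x y, s x y * (1 - θ x y) = 1)
    (hk : ∀ x y, k x y = s x y * (1 - f x y)) (hl : ∀ x y, ℓ x y = s x y * g x y)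
    (hf1 : ∀ x, (f x x).re < 1) (hθ1 : ∀ x, (θ x x).re < 1) : IsCompletePickPair k ℓ := by
  intro n N hn hN z W hW
  obtain ⟨Hg, _, _, G, hG⟩ := exists_feature _ hg
  obtain ⟨Hf, _, _, ψ, hψ⟩ := exists_feature _ hf
  obtain ⟨Hθ, _, _, τ, hτ⟩ := exists_feature _ hθ
  let M : Matrix (Fin n × Fin N) (Fin n × Fin N) ℂ := fun p q =>
    (ℓ (z p.1) (z q.1) * (if p.2 = q.2 then 1 else 0)
      - k (z p.1) (z q.1) * (W p.1 * (W q.1)ᴴ) p.2 q.2)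
  have hM : M.PosSemidef := by
    apply posSemidef_of_form
    intro c
    have := hW (fun i r => c (i, r))
    rw [pick_form_eq (fun i j => ℓ (z i) (z j)) (fun i j => k (z i) (z j))] at this
    exact this
  obtain ⟨E, _, _, h, hh⟩ := exists_feature _ hM
  let S := Submodule.span ℂ (Set.range h)
  have : FiniteDimensional ℂ S := FiniteDimensional.span_of_finite ℂ (Set.finite_range h)
  let h' : Fin n × Fin N → S := fun q => ⟨h q, Submodule.subset_span ⟨q, rfl⟩⟩
  have hh' : ∀ p q, inner ℂ (h' p) (h' q) = M p q := fun p q => hh p q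
  let e : Fin N → EuclideanSpace ℂ (Fin N) := fun r => EuclideanSpace.single r 1
  let w : Fin n × Fin N → EuclideanSpace ℂ (Fin N) :=
    fun q => WithLp.toLp 2 (fun t => (starRingEnd ℂ) (W q.1 q.2 t))
  have hw : ∀ p q, inner ℂ (w p) (w q) = (W p.1 * (W q.1)ᴴ) p.2 q.2 := by
    intro p q
    simp [w, PiLp.inner_apply, Matrix.mul_apply, mul_comm]
  have he : ∀ r t, inner ℂ (e r) (e t) = if r = t then (1 : ℂ) else 0 := by
    intro r t
    simp [e, EuclideanSpace.inner_single_left]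
  obtain ⟨A, B, _, _, _, _, _, a, J, pr₁, pr₂, mk, hp1, hp2, hBin, hain0, hBn, hJ0, haJ⟩ :=
    aux_spaces (S := S) G ψ τ e
  have hain : ∀ x r b y t b', inner ℂ (a x r b) (a y t b') =
      g x y * (if r = t then 1 else 0) + f x y * inner ℂ (pr₁ b) (pr₁ b')
        + θ x y * inner ℂ (pr₂ b) (pr₂ b') := by
    intro x r b y t b'
    rw [hain0, hG, hψ, hτ, he]
    simp only [Matrix.of_apply]
    ring
  let β : Fin n × Fin N → B := fun q => mk (w q) (h' q)
  obtain ⟨L, hL, hLα⟩ := exists_contraction (fun q : Fin n × Fin N => a (z q.1) q.2 (β q)) β (by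
    intro p q
    rw [hain]
    simp only [β, hp1, hp2, hBin, hw, hh', M, hk, hl]
    linear_combination (g (z p.1) (z q.1) * (if p.2 = q.2 then 1 else 0)
      - (1 - f (z p.1) (z q.1)) * (W p.1 * (W q.1)ᴴ) p.2 q.2) * (- hsθ (z p.1) (z q.1)))
  have hJ : ∀ x b, ‖J x b‖ ^ 2 = (f x x).re * ‖pr₁ b‖ ^ 2 + (θ x x).re * ‖pr₂ b‖ ^ 2 := by
    intro x b
    have h1 : ‖ψ x‖ ^ 2 = (f x x).re := by
      have := hψ x x
      rw [inner_self_eq_norm_sq_to_K] at this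
      have h2 := congrArg Complex.re this
      simpa [← Complex.ofReal_pow] using h2
    have h2 : ‖τ x‖ ^ 2 = (θ x x).re := by
      have := hτ x x
      rw [inner_self_eq_norm_sq_to_K] at this
      have h2 := congrArg Complex.re this
      simpa [← Complex.ofReal_pow] using h2
    rw [hJ0, h1, h2]
  have hinj : ∀ x, Function.Injective (LinearMap.id - L ∘ₗ J x : B →ₗ[ℂ] B) := by
    intro x
    rw [injective_iff_map_eq_zero]
    intro b hb
    have hb' : b = L (J x b) := by
      simpa [sub_eq_zero] using hb
    have h1 : ‖b‖ ^ 2 ≤ ‖J x b‖ ^ 2 := by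
      have := hL (J x b)
      rw [← hb'] at this
      gcongr
    rw [hJ, hBn] at h1
    have h2 := hf1 x
    have h3 := hθ1 x
    have h4 : ‖pr₁ b‖ ^ 2 = 0 := by nlinarith [sq_nonneg ‖pr₁ b‖, sq_nonneg ‖pr₂ b‖]
    have h5 : ‖pr₂ b‖ ^ 2 = 0 := by nlinarith [sq_nonneg ‖pr₁ b‖, sq_nonneg ‖pr₂ b‖]
    have h6 : ‖b‖ ^ 2 = 0 := by rw [hBn, h4, h5, add_zero]
    simpa using h6
  have hfix : ∀ x r, ∃ b : B, L (a x r b) = b := by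
    intro x r
    obtain ⟨b, hb⟩ := LinearMap.surjective_of_injective (hinj x) (L (a x r 0))
    refine ⟨b, ?_⟩
    rw [haJ, map_add, ← hb]
    simp
  have huniq : ∀ x r b b', L (a x r b) = b → L (a x r b') = b' → b = b' := by
    intro x r b b' h1 h2
    apply hinj x
    rw [haJ, map_add] at h1 h2
    simp only [LinearMap.sub_apply, LinearMap.id_apply, LinearMap.comp_apply]
    calc b - L (J x b) = L (a x r 0) := by rw [sub_eq_iff_eq_add]; exact h1.symm
      _ = _ := by rw [eq_sub_iff_add_eq]; exact h2
  choose b hb using hfix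
  let Φ : X → Matrix (Fin N) (Fin N) ℂ := fun x r t => (starRingEnd ℂ) (pr₁ (b x r) t)
  refine ⟨Φ, ?_, ?_⟩
  · let D : Matrix (X × Fin N) (X × Fin N) ℂ := fun p q =>
      inner ℂ (a p.1 p.2 (b p.1 p.2)) (a q.1 q.2 (b q.1 q.2)) - inner ℂ (b p.1 p.2) (b q.1 q.2)
    have hD : D.PosSemidef := by
      refine IsPosKernel.posSemidef (k := D) ?_
      intro m p c
      simp only [D, mul_sub, Finset.sum_sub_distrib]
      rw [form_inner (fun i => a (p i).1 (p i).2 (b (p i).1 (p i).2)),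
        form_inner (fun i => b (p i).1 (p i).2), ← Complex.ofReal_sub, Complex.zero_le_real,
        sub_nonneg]
      have := hL (∑ i, c i • a (p i).1 (p i).2 (b (p i).1 (p i).2))
      rw [map_sum] at this
      simp_rw [map_smul, hb] at this
      gcongr
    have hE : (Matrix.of fun p q : X × Fin N => inner ℂ (pr₂ (b p.1 p.2)) (pr₂ (b q.1 q.2))).PosSemidef := by
      refine IsPosKernel.posSemidef ?_
      intro m p c
      rw [form_inner (fun i => (pr₂ (b (p i).1 (p i).2))), Complex.zero_le_real]
      positivity
    have hR := ((hs.submatrix (Prod.fst : X × Fin N → X)).hadamard hD).add hE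
    intro m p u
    rw [pick_form_eq (fun i j => ℓ (p i) (p j)) (fun i j => k (p i) (p j))]
    have := posSemidef_fintype hR (fun q : Fin m × Fin N => (p q.1, q.2)) (fun q => u q.1 q.2)
    refine this.trans_eq ?_
    refine Finset.sum_congr rfl fun i _ => Finset.sum_congr rfl fun j _ => ?_
    congr 1
    have hΦ : (Φ (p i.1) * (Φ (p j.1))ᴴ) i.2 j.2 =
        inner ℂ (pr₁ (b (p i.1) i.2)) (pr₁ (b (p j.1) j.2)) := by
      rw [Matrix.mul_apply]
      rw [PiLp.inner_apply]
      refine Finset.sum_congr rfl fun t _ => ?_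
      rw [Matrix.conjTranspose_apply]
      simp [Φ, mul_comm]
    have hDv : D (p i.1, i.2) (p j.1, j.2) = inner ℂ (a (p i.1) i.2 (b (p i.1) i.2))
        (a (p j.1) j.2 (b (p j.1) j.2)) - inner ℂ (b (p i.1) i.2) (b (p j.1) j.2) := rfl
    rw [hΦ]
    simp only [Matrix.add_apply, Matrix.hadamard_apply, Matrix.submatrix_apply, Matrix.of_apply, hDv,
      hain, hBin, hk, hl]
    have := hsθ (p i.1) (p j.1)
    linear_combination (- inner ℂ (pr₂ (b (p i.1) i.2)) (pr₂ (b (p j.1) j.2))) * this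
  · intro i
    ext r t
    have h1 : b (z i) r = β (i, r) := huniq _ _ _ _ (hb _ _) (hLα (i, r))
    simp [Φ, h1, β, w, hp1]

instance pickHasAnti {g : ℕ} : Finset.HasAntidiagonal (Fin g → ℕ) where
  antidiagonal n := (Finset.Iic n ×ˢ Finset.Iic n).filter fun uv => uv.1 + uv.2 = n
  mem_antidiagonal {n} {a} := by
    simp only [Finset.mem_filter, and_iff_right_iff_imp]
    intro h
    simp [← h]

/-- Convolution of coefficient families. -/
def cconv {g : ℕ} {R : Type*} [NonUnitalNonAssocSemiring R] (κ κ' : (Fin g → ℕ) → R) (b : Fin g → ℕ) : R :=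
  ∑ p ∈ Finset.HasAntidiagonal.antidiagonal b, κ p.1 * κ' p.2

lemma cconv_eq_Icc {g : ℕ} {R : Type*} [NonUnitalNonAssocSemiring R] (κ κ' : (Fin g → ℕ) → R)
    (b : Fin g → ℕ) : cconv κ κ' b = ∑ w ∈ Finset.Icc 0 b, κ w * κ' (b - w) := by
  unfold cconv
  symm
  refine Finset.sum_bij (fun w _ => (w, b - w)) ?_ ?_ ?_ ?_
  · intro w hw
    rw [Finset.mem_Icc] at hw
    rw [Finset.HasAntidiagonal.mem_antidiagonal]
    exact add_tsub_cancel_of_le hw.2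
  · intro w _ w' _ h
    exact (Prod.mk.inj h).1
  · rintro ⟨u, v⟩ h
    rw [Finset.HasAntidiagonal.mem_antidiagonal] at h
    refine ⟨u, ?_, ?_⟩
    · rw [Finset.mem_Icc, ← h]; exact ⟨zero_le, by simp⟩
    · subst h; simp
  · intros; rfl

lemma cconv_comm {g : ℕ} {R : Type*} [NonUnitalCommSemiring R] (κ κ' : (Fin g → ℕ) → R) :
    cconv κ κ' = cconv κ' κ := by
  funext b
  unfold cconv
  refine Finset.sum_nbij' Prod.swap Prod.swap ?_ ?_ ?_ ?_ ?_
  · rintro ⟨x, y⟩ h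
    rw [Finset.HasAntidiagonal.mem_antidiagonal] at h ⊢
    rw [← h]; exact add_comm _ _
  · rintro ⟨x, y⟩ h
    rw [Finset.HasAntidiagonal.mem_antidiagonal] at h ⊢
    rw [← h]; exact add_comm _ _
  · intros; rfl
  · intros; rfl
  · intros; exact mul_comm _ _

lemma cconv_assoc {g : ℕ} {R : Type*} [NonUnitalSemiring R] (κ κ' κ'' : (Fin g → ℕ) → R) :
    cconv (cconv κ κ') κ'' = cconv κ (cconv κ' κ'') := by
  funext b
  unfold cconv
  simp only [Finset.sum_mul, Finset.mul_sum]
  rw [Finset.sum_sigma', Finset.sum_sigma']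
  refine Finset.sum_nbij' (fun x => ⟨(x.2.1, x.2.2 + x.1.2), (x.2.2, x.1.2)⟩)
    (fun x => ⟨(x.1.1 + x.2.1, x.2.2), (x.1.1, x.2.1)⟩) ?_ ?_ ?_ ?_ ?_
  · rintro ⟨⟨a, b⟩, ⟨c, d⟩⟩ h
    simp only [Finset.mem_sigma, Finset.HasAntidiagonal.mem_antidiagonal] at h ⊢
    rw [← h.1, ← h.2]; exact ⟨(add_assoc _ _ _).symm, trivial⟩
  · rintro ⟨⟨a, b⟩, ⟨c, d⟩⟩ h
    simp only [Finset.mem_sigma, Finset.HasAntidiagonal.mem_antidiagonal] at h ⊢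
    rw [← h.1, ← h.2]; exact ⟨(add_assoc _ _ _), trivial⟩
  · rintro ⟨⟨a, b⟩, ⟨c, d⟩⟩ h
    simp only [Finset.mem_sigma, Finset.HasAntidiagonal.mem_antidiagonal] at h ⊢
    simp only [h.2]
  · rintro ⟨⟨a, b⟩, ⟨c, d⟩⟩ h
    simp only [Finset.mem_sigma, Finset.HasAntidiagonal.mem_antidiagonal] at h ⊢
    simp only [h.2]
  · rintro ⟨⟨a, b⟩, ⟨c, d⟩⟩ _
    exact mul_assoc _ _ _

lemma cconv_summable {g : ℕ} {f f' : (Fin g → ℕ) → ℂ} (hf : Summable fun a => ‖f a‖)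
    (hf' : Summable fun a => ‖f' a‖) :
    Summable (fun b => ‖cconv f f' b‖) ∧ (∑' a, f a) * (∑' a, f' a) = ∑' b, cconv f f' b := by
  constructor
  · have := summable_sum_mul_antidiagonal_of_summable_mul
      (Summable.mul_of_nonneg hf hf' (fun _ => norm_nonneg _) fun _ => norm_nonneg _)
    refine this.of_nonneg_of_le (fun _ => norm_nonneg _) (fun n ↦ ?_)
    refine (norm_sum_le _ _).trans (Finset.sum_le_sum fun p _ => norm_mul_le _ _)
  · exact hf.of_norm.tsum_mul_tsum_eq_tsum_sum_antidiagonal hf'.of_norm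
      (summable_mul_of_summable_norm hf hf')

lemma mpow_add {g : ℕ} (z : Fin g → ℂ) (a b : Fin g → ℕ) : mpow z (a + b) = mpow z a * mpow z b := by
  simp [mpow, pow_add, Finset.prod_mul_distrib]

lemma mpow_zero {g : ℕ} (z : Fin g → ℂ) : mpow z 0 = 1 := by simp [mpow]

/-- absolute summability of a coefficient family at a point. -/
def SumAt {g : ℕ} (κ : (Fin g → ℕ) → ℝ) (x : Fin g → ℂ) : Prop :=
  Summable fun a => |κ a| * ‖mpow x a‖ ^ 2

lemma diag_summable {g : ℕ} {κ : (Fin g → ℕ) → ℝ} {z w : Fin g → ℂ} (hz : SumAt κ z) (hw : SumAt κ w) :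
    Summable fun a => ‖(κ a : ℂ) * mpow z a * (starRingEnd ℂ) (mpow w a)‖ := by
  refine (hz.add hw).of_nonneg_of_le (fun _ => norm_nonneg _) fun a => ?_
  simp only [norm_mul, Complex.norm_real, Real.norm_eq_abs, RCLike.norm_conj]
  rw [← mul_add, mul_assoc]
  refine mul_le_mul_of_nonneg_left ?_ (abs_nonneg _)
  nlinarith [sq_nonneg (‖mpow z a‖ - ‖mpow w a‖), sq_nonneg ‖mpow z a‖, sq_nonneg ‖mpow w a‖]

lemma cconv_term {g : ℕ} (κ κ' : (Fin g → ℕ) → ℝ) (z w : Fin g → ℂ) (b : Fin g → ℕ) :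
    cconv (fun a => (κ a : ℂ) * mpow z a * (starRingEnd ℂ) (mpow w a))
      (fun a => (κ' a : ℂ) * mpow z a * (starRingEnd ℂ) (mpow w a)) b =
    ((cconv κ κ' b : ℝ) : ℂ) * mpow z b * (starRingEnd ℂ) (mpow w b) := by
  unfold cconv
  push_cast
  rw [Finset.sum_mul, Finset.sum_mul]
  refine Finset.sum_congr rfl fun p hp => ?_
  rw [Finset.HasAntidiagonal.mem_antidiagonal] at hp
  rw [← hp, mpow_add, mpow_add, map_mul]
  ring

lemma diag_mul {g : ℕ} {κ κ' : (Fin g → ℕ) → ℝ} {z w : Fin g → ℂ} (hz : SumAt κ z) (hw : SumAt κ w)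
    (hz' : SumAt κ' z) (hw' : SumAt κ' w) :
    diagKer κ z w * diagKer κ' z w = diagKer (cconv κ κ') z w := by
  have := (cconv_summable (diag_summable hz hw) (diag_summable hz' hw')).2
  simp_rw [cconv_term] at this
  exact this

lemma sumAt_iff {g : ℕ} {κ : (Fin g → ℕ) → ℝ} {z : Fin g → ℂ} :
    SumAt κ z ↔ Summable fun a => ‖(κ a : ℂ) * mpow z a * (starRingEnd ℂ) (mpow z a)‖ := by
  unfold SumAt
  simp only [norm_mul, Complex.norm_real, Real.norm_eq_abs, RCLike.norm_conj]
  simp_rw [sq, mul_assoc]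

lemma sumAt_cconv {g : ℕ} {κ κ' : (Fin g → ℕ) → ℝ} {z : Fin g → ℂ} (hz : SumAt κ z)
    (hz' : SumAt κ' z) : SumAt (cconv κ κ') z := by
  have := (cconv_summable (diag_summable hz hz) (diag_summable hz' hz')).1
  simp_rw [cconv_term] at this
  exact sumAt_iff.2 this

lemma diag_form {g : ℕ} {ι : Type*} [Fintype ι] {κ : (Fin g → ℕ) → ℝ} (z : ι → Fin g → ℂ)
    (hz : ∀ i, SumAt κ (z i)) (c : ι → ℂ) :
    HasSum (fun a => ((κ a * ‖∑ i, (starRingEnd ℂ) (c i) * mpow (z i) a‖ ^ 2 : ℝ) : ℂ))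
      (∑ i, ∑ j, (starRingEnd ℂ) (c i) * c j * diagKer κ (z i) (z j)) := by
  have h : HasSum (fun a => ∑ i, ∑ j, (starRingEnd ℂ) (c i) * c j *
      ((κ a : ℂ) * mpow (z i) a * (starRingEnd ℂ) (mpow (z j) a)))
      (∑ i, ∑ j, (starRingEnd ℂ) (c i) * c j * diagKer κ (z i) (z j)) :=
    hasSum_sum fun i _ => hasSum_sum fun j _ =>
      ((diag_summable (hz i) (hz j)).of_norm.hasSum).mul_left _
  convert h using 2 with a
  push_cast
  rw [← Complex.conj_mul', map_sum, Finset.sum_mul_sum, Finset.mul_sum, Finset.sum_comm]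
  refine Finset.sum_congr rfl fun i _ => ?_
  rw [Finset.mul_sum]
  refine Finset.sum_congr rfl fun j _ => ?_
  simp only [map_mul, Complex.conj_conj]
  ring

lemma diag_form_real {g : ℕ} {ι : Type*} [Fintype ι] {κ : (Fin g → ℕ) → ℝ} (z : ι → Fin g → ℂ)
    (hz : ∀ i, SumAt κ (z i)) (c : ι → ℂ) :
    ∃ s : ℝ, HasSum (fun a => κ a * ‖∑ i, (starRingEnd ℂ) (c i) * mpow (z i) a‖ ^ 2) s ∧
      ∑ i, ∑ j, (starRingEnd ℂ) (c i) * c j * diagKer κ (z i) (z j) = (s : ℂ) := by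
  have h := diag_form z hz c
  have h1 : Summable (fun a => κ a * ‖∑ i, (starRingEnd ℂ) (c i) * mpow (z i) a‖ ^ 2) := by
    rw [← Complex.summable_ofReal]; exact h.summable
  exact ⟨_, h1.hasSum, h.unique (Complex.hasSum_ofReal.2 h1.hasSum)⟩

lemma diag_isPosKernel {g : ℕ} {X : Type*} {κ : (Fin g → ℕ) → ℝ} (z : X → Fin g → ℂ)
    (hz : ∀ i, SumAt κ (z i)) (hκ : ∀ a, 0 ≤ κ a) :
    IsPosKernel (fun x y => diagKer κ (z x) (z y)) := by
  intro n p c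
  obtain ⟨s, h1, h2⟩ := diag_form_real (fun i => z (p i)) (fun i => hz _) c
  rw [h2, Complex.zero_le_real]
  exact h1.nonneg fun a => mul_nonneg (hκ a) (by positivity)

lemma diag_diag {g : ℕ} {κ : (Fin g → ℕ) → ℝ} (z : Fin g → ℂ) :
    diagKer κ z z = ((∑' a, κ a * ‖mpow z a‖ ^ 2 : ℝ) : ℂ) := by
  unfold diagKer
  rw [Complex.ofReal_tsum]
  refine tsum_congr fun a => ?_
  rw [mul_assoc, Complex.mul_conj']
  push_cast; ring

/-- coefficients of the constant kernel one -/
def cdel {g : ℕ} (a : Fin g → ℕ) : ℝ := if a = 0 then 1 else 0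

lemma sumAt_cdel {g : ℕ} (z : Fin g → ℂ) : SumAt (cdel (g := g)) z := by
  refine summable_of_ne_finset_zero (s := {0}) fun a ha => ?_
  simp only [Finset.mem_singleton] at ha
  simp [cdel, ha]

lemma diag_cdel {g : ℕ} (z w : Fin g → ℂ) : diagKer cdel z w = 1 := by
  unfold diagKer
  rw [tsum_eq_single 0]
  · simp [cdel, mpow_zero]
  · intro a ha
    simp [cdel, ha]

lemma sumAt_add {g : ℕ} {κ κ' : (Fin g → ℕ) → ℝ} {z : Fin g → ℂ} (h : SumAt κ z) (h' : SumAt κ' z) :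
    SumAt (fun a => κ a + κ' a) z := by
  refine (h.add h').of_nonneg_of_le (fun _ => by positivity) fun a => ?_
  rw [← add_mul]
  exact mul_le_mul_of_nonneg_right (abs_add_le _ _) (by positivity)

lemma sumAt_sub {g : ℕ} {κ κ' : (Fin g → ℕ) → ℝ} {z : Fin g → ℂ} (h : SumAt κ z) (h' : SumAt κ' z) :
    SumAt (fun a => κ a - κ' a) z := by
  refine (h.add h').of_nonneg_of_le (fun _ => by positivity) fun a => ?_
  rw [← add_mul]
  exact mul_le_mul_of_nonneg_right (abs_sub _ _) (by positivity)

lemma diag_add {g : ℕ} {κ κ' : (Fin g → ℕ) → ℝ} {z w : Fin g → ℂ} (h : SumAt κ z) (hw : SumAt κ w)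
    (h' : SumAt κ' z) (hw' : SumAt κ' w) :
    diagKer (fun a => κ a + κ' a) z w = diagKer κ z w + diagKer κ' z w := by
  unfold diagKer
  rw [← (diag_summable h hw).of_norm.tsum_add (diag_summable h' hw').of_norm]
  refine tsum_congr fun a => ?_
  push_cast; ring

lemma diag_sub {g : ℕ} {κ κ' : (Fin g → ℕ) → ℝ} {z w : Fin g → ℂ} (h : SumAt κ z) (hw : SumAt κ w)
    (h' : SumAt κ' z) (hw' : SumAt κ' w) :
    diagKer (fun a => κ a - κ' a) z w = diagKer κ z w - diagKer κ' z w := by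
  unfold diagKer
  rw [← (diag_summable h hw).of_norm.tsum_sub (diag_summable h' hw').of_norm]
  refine tsum_congr fun a => ?_
  push_cast; ring

lemma cert_nonneg {g : ℕ} {kc θ : (Fin g → ℕ) → ℝ} (hpos : ∀ a, 0 < kc a) (h : IsMasterCert kc θ)
    (b : Fin g → ℕ) : 0 ≤ θ b := by
  rcases Nat.lt_or_ge (∑ i, b i) 1 with h1 | h1
  · have : b = 0 := by
      funext i
      have : b i ≤ ∑ i, b i := Finset.single_le_sum (fun _ _ => Nat.zero_le _) (Finset.mem_univ i)
      simp; omega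
    rw [this, h.1]
  · rcases Nat.lt_or_ge (∑ i, b i) 2 with h2 | h2
    · rw [h.2.1 b (by omega)]; exact (hpos b).le
    · rw [h.2.2 b h2]; exact le_max_left _ _

lemma eq_zero_or_of_deg_one {g : ℕ} {b w : Fin g → ℕ} (hb : ∑ i, b i = 1) (hw : w ≤ b) :
    w = 0 ∨ w = b := by
  have h1 : ∑ i, w i + ∑ i, (b - w) i = ∑ i, b i := by
    rw [← Finset.sum_add_distrib]
    refine Finset.sum_congr rfl fun i _ => ?_
    have h5 : w i ≤ b i := hw i
    show w i + (b i - w i) = b i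
    omega
  rcases Nat.eq_zero_or_pos (∑ i, w i) with h | h
  · left
    funext i
    have : w i ≤ ∑ i, w i := Finset.single_le_sum (fun _ _ => Nat.zero_le _) (Finset.mem_univ i)
    simp; omega
  · right
    have h2 : ∑ i, (b - w) i = 0 := by omega
    funext i
    have : (b - w) i ≤ ∑ i, (b - w) i :=
      Finset.single_le_sum (fun _ _ => Nat.zero_le _) (Finset.mem_univ i)
    have h5 : w i ≤ b i := hw i
    simp only [Pi.sub_apply] at *
    omega

lemma cert_split {g : ℕ} {kc θ : (Fin g → ℕ) → ℝ} (h0 : kc 0 = 1) (h : IsMasterCert kc θ)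
    (b : Fin g → ℕ) (hb : b ≠ 0) :
    cconv θ kc b = (∑ w ∈ Finset.Icc (0 : Fin g → ℕ) b,
        if w ≠ 0 ∧ w ≠ b then θ w * kc (b - w) else 0) + θ b := by
  rw [cconv_eq_Icc]
  have h2 : ∑ w ∈ Finset.Icc (0 : Fin g → ℕ) b, (if w = b then θ b else 0) = θ b := by
    rw [Finset.sum_ite_eq']
    simp
  rw [← h2, ← Finset.sum_add_distrib]
  refine Finset.sum_congr rfl fun w _ => ?_
  by_cases h3 : w = b
  · subst h3; simp [h0]
  · by_cases h4 : w = 0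
    · subst h4; simp [h.1, Ne.symm hb]
    · simp [h3, h4]

lemma cert_f {g : ℕ} {kc θ : (Fin g → ℕ) → ℝ} (h0 : kc 0 = 1) 
    (h : IsMasterCert kc θ) (b : Fin g → ℕ) :
    0 ≤ cconv θ kc b - kc b + cdel b ∧ (θ b ≠ 0 → cconv θ kc b - kc b + cdel b = 0) := by
  by_cases hb : b = 0
  · subst hb
    rw [cconv_eq_Icc]
    simp [h.1, h0, cdel]
  rw [cert_split h0 h b hb]
  simp only [cdel, hb, if_false, add_zero]
  rcases Nat.lt_or_ge (∑ i, b i) 2 with h2 | h2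
  · have h1 : ∑ i, b i = 1 := by
      have : ∑ i, b i ≠ 0 := by
        intro h3
        apply hb
        funext i
        exact Finset.sum_eq_zero_iff.1 h3 i (Finset.mem_univ i)
      omega
    rw [Finset.sum_eq_zero, h.2.1 b h1]
    · simp
    · intro w hw
      rw [if_neg]
      rw [Finset.mem_Icc] at hw
      rcases eq_zero_or_of_deg_one h1 hw.2 with h | h <;> simp [h]
  · have := h.2.2 b h2
    set x := ∑ w ∈ Finset.Icc (0 : Fin g → ℕ) b, if w ≠ 0 ∧ w ≠ b then θ w * kc (b - w) else 0
    rw [this]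
    constructor
    · have := le_max_right 0 (kc b - x)
      linarith
    · intro h3
      rcases max_choice 0 (kc b - x) with h4 | h4
      · exact absurd h4 h3
      · rw [h4]; ring

lemma IsPosKernel.pow {X : Type*} {k : X → X → ℂ} (hk : IsPosKernel k) (n : ℕ) :
    IsPosKernel (fun x y => k x y ^ n) := by
  induction n with
  | zero =>
    intro m z c
    simp only [pow_zero, mul_one]
    rw [← Finset.sum_mul_sum, ← map_sum, Complex.conj_mul']
    exact_mod_cast sq_nonneg ‖∑ i, c i‖
  | succ n ih =>
    have := PosSemidef.isPosKernel (ih.posSemidef.hadamard hk.posSemidef)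
    intro m z c
    exact this m z c

lemma IsPosKernel.geom {X : Type*} {k : X → X → ℂ} (hk : IsPosKernel k) (h1 : ∀ x y, ‖k x y‖ < 1) :
    IsPosKernel (fun x y => (1 - k x y)⁻¹) := by
  intro m z c
  have h : HasSum (fun n => ∑ i, ∑ j, (starRingEnd ℂ) (c i) * c j * k (z i) (z j) ^ n)
      (∑ i, ∑ j, (starRingEnd ℂ) (c i) * c j * (1 - k (z i) (z j))⁻¹) :=
    hasSum_sum fun i _ => hasSum_sum fun j _ =>
      (hasSum_geometric_of_norm_lt_one (h1 _ _)).mul_left _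
  exact h.nonneg fun n => hk.pow n m z c

lemma sumAt_of_nonneg {g : ℕ} {κ : (Fin g → ℕ) → ℝ} {z : Fin g → ℂ} (h : ∀ a, 0 ≤ κ a)
    (hs : Summable fun a => κ a * ‖mpow z a‖ ^ 2) : SumAt κ z := by
  unfold SumAt
  simpa only [abs_of_nonneg (h _)] using hs

lemma diag_norm_lt {g : ℕ} {κ : (Fin g → ℕ) → ℝ} {z w : Fin g → ℂ} (h : ∀ a, 0 ≤ κ a)
    (hz : SumAt κ z) (hw : SumAt κ w) (hz1 : (∑' a, κ a * ‖mpow z a‖ ^ 2) < 1)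
    (hw1 : (∑' a, κ a * ‖mpow w a‖ ^ 2) < 1) : ‖diagKer κ z w‖ < 1 := by
  unfold SumAt at hz hw
  simp only [abs_of_nonneg (h _)] at hz hw
  have h2 : ‖diagKer κ z w‖ ≤ ∑' a, (κ a * ‖mpow z a‖ ^ 2 + κ a * ‖mpow w a‖ ^ 2) / 2 := by
    refine tsum_of_norm_bounded ((hz.add hw).div_const 2).hasSum fun a => ?_
    simp only [norm_mul, Complex.norm_real, Real.norm_eq_abs, RCLike.norm_conj, abs_of_nonneg (h a)]
    nlinarith [mul_nonneg (h a) (sq_nonneg (‖mpow z a‖ - ‖mpow w a‖))]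
  rw [tsum_div_const, hz.tsum_add hw] at h2
  linarith

lemma tsum_theta {g : ℕ} {θ : (Fin g → ℕ) → ℝ} (h0 : θ 0 = 0) (z w : Fin g → ℂ) :
    (∑' a : Fin g → ℕ,
      if a = 0 then 0 else (θ a : ℂ) * mpow z a * (starRingEnd ℂ) (mpow w a)) = diagKer θ z w := by
  refine tsum_congr fun a => ?_
  split_ifs with h
  · simp [h, h0]
  · rfl

lemma term_theta {g : ℕ} {θ : (Fin g → ℕ) → ℝ} (h0 : θ 0 = 0) (z : Fin g → ℂ) :
    (fun a : Fin g → ℕ => if a = 0 then 0 else θ a * ‖mpow z a‖ ^ 2) =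
      fun a => θ a * ‖mpow z a‖ ^ 2 := by
  funext a
  split_ifs with h
  · simp [h, h0]
  · rfl

theorem diag_sufficiency {g : ℕ} (Ω : Set (Fin g → ℂ)) (kc ℓc : (Fin g → ℕ) → ℝ)
    (hk : IsNormalizedDiag Ω kc) 
    (θ : (Fin g → ℕ) → ℝ) (hθ : IsMasterCert kc θ)
    (ha : ∀ x ∈ Ω, Summable (fun a : Fin g → ℕ => θ a * ‖mpow x a‖ ^ 2) ∧
          (∑' a : Fin g → ℕ, θ a * ‖mpow x a‖ ^ 2) < 1)
    (hb : IsPosKernel (fun z w : Ω => diagKer ℓc ↑z ↑w * (1 - diagKer θ ↑z ↑w))) :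
    IsCompletePickPair (fun z w : Ω => diagKer kc ↑z ↑w) (fun z w : Ω => diagKer ℓc ↑z ↑w) := by
  obtain ⟨hk0, hkp, hks⟩ := hk
  have hθ0 := cert_nonneg hkp hθ
  have Sθ : ∀ x : Ω, SumAt θ x := fun x => sumAt_of_nonneg hθ0 (ha x x.2).1
  have Sk : ∀ x : Ω, SumAt kc x := fun x => sumAt_of_nonneg (fun a => (hkp a).le) (hks x x.2)
  have hlt : ∀ x y : Ω, ‖diagKer θ x y‖ < 1 := fun x y =>
    diag_norm_lt hθ0 (Sθ x) (Sθ y) (ha x x.2).2 (ha y y.2).2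
  have hne : ∀ x y : Ω, 1 - diagKer θ x y ≠ 0 := by
    intro x y h
    have := hlt x y
    rw [sub_eq_zero] at h
    rw [← h] at this
    simp at this
  have Pθ : IsPosKernel (fun x y : Ω => diagKer θ x y) := diag_isPosKernel _ Sθ hθ0
  let fc : (Fin g → ℕ) → ℝ := fun b => cconv θ kc b - kc b + cdel b
  have Sf : ∀ x : Ω, SumAt fc x := fun x =>
    sumAt_add (sumAt_sub (sumAt_cconv (Sθ x) (Sk x)) (Sk x)) (sumAt_cdel _)
  have hfc : ∀ x y : Ω, diagKer fc x y = 1 - diagKer kc x y * (1 - diagKer θ x y) := by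
    intro x y
    rw [diag_add (sumAt_sub (sumAt_cconv (Sθ x) (Sk x)) (Sk x))
      (sumAt_sub (sumAt_cconv (Sθ y) (Sk y)) (Sk y)) (sumAt_cdel _) (sumAt_cdel _), diag_cdel,
      diag_sub (sumAt_cconv (Sθ x) (Sk x)) (sumAt_cconv (Sθ y) (Sk y)) (Sk x) (Sk y),
      ← diag_mul (Sθ x) (Sθ y) (Sk x) (Sk y)]
    ring
  have Pf : IsPosKernel (fun x y : Ω => diagKer fc x y) :=
    diag_isPosKernel _ Sf fun b => (cert_f hk0 hθ b).1
  refine suff_abstract _ _ (fun x y : Ω => (1 - diagKer θ x y)⁻¹) (fun x y : Ω => diagKer fc x y)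
    (fun x y : Ω => diagKer θ x y) (fun z w : Ω => diagKer ℓc ↑z ↑w * (1 - diagKer θ ↑z ↑w))
    (Pθ.geom hlt).posSemidef Pf.posSemidef Pθ.posSemidef hb.posSemidef ?_ ?_ ?_ ?_ ?_
  · intro x y
    exact inv_mul_cancel₀ (hne x y)
  · intro x y
    rw [hfc]
    field_simp [hne x y]
    ring
  · intro x y
    field_simp [hne x y]
  · intro x
    rw [hfc, diag_diag, diag_diag, ← Complex.ofReal_one, ← Complex.ofReal_sub, ← Complex.ofReal_mul,
      ← Complex.ofReal_sub, Complex.ofReal_re]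
    have h1 := (ha x x.2).2
    have h2 : 0 < ∑' a, kc a * ‖mpow (x : Fin g → ℂ) a‖ ^ 2 :=
      (hks x x.2).tsum_pos (fun a => mul_nonneg (hkp a).le (sq_nonneg _)) 0 (by simp [hk0, mpow_zero])
    nlinarith
  · intro x
    rw [diag_diag, Complex.ofReal_re]
    exact (ha x x.2).2

lemma row_pick {X : Type*} {k ℓ : X → X → ℂ} (hp : IsCompletePickPair k ℓ) (hℓ : IsPosKernel ℓ)
    {ι R : Type*} [Fintype ι] [Nonempty ι] [Fintype R] [Nonempty R] (z : ι → X) (w : ι → R → ℂ)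
    (hw : ∀ c : ι → ℂ, 0 ≤ ∑ i, ∑ j, (starRingEnd ℂ) (c i) * c j *
      (ℓ (z i) (z j) - k (z i) (z j) * ∑ r, w i r * (starRingEnd ℂ) (w j r))) :
    ∃ φ : X → R → ℂ, (∀ i, φ (z i) = w i) ∧
      IsPosKernel (fun x y => ℓ x y - k x y * ∑ r, φ x r * (starRingEnd ℂ) (φ y r)) := by
  let eι := (Fintype.equivFin ι).symm
  let eR := (Fintype.equivFin R).symm
  have hN : 0 < Fintype.card R := Fintype.card_pos
  let o : Fin (Fintype.card R) := ⟨0, hN⟩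
  let W : Fin (Fintype.card ι) → Matrix (Fin (Fintype.card R)) (Fin (Fintype.card R)) ℂ :=
    fun i => Matrix.of fun r t => if r = o then w (eι i) (eR t) else 0
  have hWW : ∀ i j r t, (W i * (W j)ᴴ) r t =
      if r = o ∧ t = o then ∑ s, w (eι i) s * (starRingEnd ℂ) (w (eι j) s) else 0 := by
    intro i j r t
    rw [Matrix.mul_apply]
    by_cases hr : r = o
    · by_cases ht : t = o
      · simp only [hr, ht, and_self, if_true]
        rw [← eR.sum_comp]
        simp [W]
      · simp [W, hr, ht]
    · simp [W, hr]
  obtain ⟨Φ, h1, h2⟩ := hp _ _ Fintype.card_pos hN (fun i => z (eι i)) W (by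
    intro u
    rw [pick_form_eq (fun i j => ℓ (z (eι i)) (z (eι j))) (fun i j => k (z (eι i)) (z (eι j)))]
    simp_rw [hWW]
    have key : ∀ r, 0 ≤ ∑ i, ∑ j, (starRingEnd ℂ) (u i r) * u j r *
        (ℓ (z (eι i)) (z (eι j)) - if r = o then k (z (eι i)) (z (eι j)) *
          ∑ s, w (eι i) s * (starRingEnd ℂ) (w (eι j) s) else 0) := by
      intro r
      by_cases hr : r = o
      · simp only [hr, if_true]
        have := hw (fun i => u (eι.symm i) o)
        rw [← eι.sum_comp] at this
        simp_rw [← eι.sum_comp (g := fun j => _ * _ * (ℓ _ (z j) - _))] at this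
        simpa using this
      · simp only [hr, if_false, sub_zero]
        exact hℓ _ (fun i => z (eι i)) (fun i => u i r)
    refine (Finset.sum_nonneg fun r (_ : r ∈ Finset.univ) => key r).trans_eq ?_
    simp_rw [Fintype.sum_prod_type]
    rw [Finset.sum_comm]
    refine Finset.sum_congr rfl fun i _ => Finset.sum_congr rfl fun r _ => 
      Finset.sum_congr rfl fun j _ => ?_
    rw [Finset.sum_eq_single r]
    · by_cases hr : r = o <;> simp [hr]
    · intro t _ ht
      by_cases hr : r = o
      · have : ¬ t = o := by rw [← hr]; exact ht
        simp [this, ht.symm]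
      · simp [hr, ht.symm]
    · simp)
  refine ⟨fun x s => Φ x o (eR.symm s), ?_, ?_⟩
  · intro i
    funext s
    have := h2 (eι.symm i)
    simp only [Equiv.apply_symm_apply] at this
    show Φ (z i) o (eR.symm s) = w i s
    rw [this]
    simp [W]
  · intro n p c
    have := h1 n p (fun i r => if r = o then c i else 0)
    rw [pick_form_eq (fun i j => ℓ (p i) (p j)) (fun i j => k (p i) (p j))] at this
    refine this.trans_eq ?_
    simp_rw [Fintype.sum_prod_type]
    refine Finset.sum_congr rfl fun i _ => ?_
    rw [Finset.sum_eq_single o (by intro r _ hr; simp [hr]) (by simp)]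
    refine Finset.sum_congr rfl fun j _ => ?_
    rw [Finset.sum_eq_single o (by intro r _ hr; simp [hr]) (by simp)]
    simp only [if_true, mul_one]
    rw [Matrix.mul_apply, ← eR.sum_comp]
    simp

/-- multi-indices of total degree at most `M`. -/
def degLE (g M : ℕ) : Finset (Fin g → ℕ) :=
  (Finset.Iic (fun _ => M)).filter fun a => ∑ i, a i ≤ M

lemma mem_degLE {g M : ℕ} {a : Fin g → ℕ} : a ∈ degLE g M ↔ ∑ i, a i ≤ M := by
  simp only [degLE, Finset.mem_filter, Finset.mem_Iic, and_iff_right_iff_imp]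
  intro h i
  exact (Finset.single_le_sum (fun _ _ => Nat.zero_le _) (Finset.mem_univ i)).trans h

/-- integer point as complex vector -/
def ncv {g : ℕ} (p : Fin g → ℕ) : Fin g → ℂ := fun i => (p i : ℂ)

lemma uni_inj {g M : ℕ} (x : (Fin g → ℕ) → ℂ)
    (hx : ∀ a ∈ degLE g M, ∑ p ∈ degLE g M, x p * mpow (ncv p) a = 0) :
    ∀ p ∈ degLE g M, x p = 0 := by
  by_contra! hne
  have hS : ((degLE g M).filter fun p => x p ≠ 0).Nonempty := by
    obtain ⟨p, hp, h⟩ := hne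
    exact ⟨p, by simp [hp, h]⟩
  obtain ⟨p, hp, hmax⟩ := Finset.exists_max_image _ (fun p : Fin g → ℕ => ∑ i, p i) hS
  rw [Finset.mem_filter] at hp
  let q : MvPolynomial (Fin g) ℂ :=
    ∏ i, ∏ j ∈ Finset.range (p i), (MvPolynomial.X i - MvPolynomial.C (j : ℂ))
  have hdeg : q.totalDegree ≤ M := by
    refine (MvPolynomial.totalDegree_finset_prod _ _).trans (le_trans ?_ (mem_degLE.1 hp.1))
    refine Finset.sum_le_sum fun i _ => ?_
    refine (MvPolynomial.totalDegree_finset_prod _ _).trans ?_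
    refine (Finset.sum_le_card_nsmul _ _ 1 fun j _ => ?_).trans (by simp)
    refine (MvPolynomial.totalDegree_sub_C_le _ _).trans ?_
    simp
  have hzero : ∑ s ∈ degLE g M, x s * MvPolynomial.eval (ncv s) q = 0 := by
    simp_rw [MvPolynomial.eval_eq', Finset.mul_sum]
    rw [Finset.sum_comm]
    refine Finset.sum_eq_zero fun d hd => ?_
    have h1 := MvPolynomial.le_totalDegree hd
    have h2 : (fun i => d i) ∈ degLE g M := by
      rw [mem_degLE]
      refine le_trans ?_ hdeg
      rw [Finsupp.sum_fintype _ _ (fun _ => rfl)] at h1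
      exact h1
    have h3 := hx _ h2
    calc _ = q.coeff d * ∑ s ∈ degLE g M, x s * mpow (ncv s) (fun i => d i) := by
          rw [Finset.mul_sum]
          refine Finset.sum_congr rfl fun s _ => ?_
          simp only [mpow]; ring
      _ = 0 := by rw [h3, mul_zero]
  have hev : ∀ s, MvPolynomial.eval (ncv s) q = ∏ i, ∏ j ∈ Finset.range (p i), ((s i : ℂ) - j) := by
    intro s
    simp [q, ncv, map_prod]
  rw [Finset.sum_eq_single p] at hzero
  · rcases mul_eq_zero.1 hzero with h | h
    · exact hp.2 h
    · rw [hev, Finset.prod_eq_zero_iff] at h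
      obtain ⟨i, _, h⟩ := h
      rw [Finset.prod_eq_zero_iff] at h
      obtain ⟨j, hj, h⟩ := h
      rw [Finset.mem_range] at hj
      rw [sub_eq_zero] at h
      have : p i = j := by exact_mod_cast h
      omega
  · intro s hs hsp
    by_cases hxs : x s = 0
    · rw [hxs, zero_mul]
    have h1 := hmax s (by simp [hs, hxs])
    have h2 : ∃ i, s i < p i := by
      by_contra! h
      have h3 : ∑ i, p i ≤ ∑ i, s i := Finset.sum_le_sum fun i _ => h i
      have h4 : ∑ i, p i = ∑ i, s i := le_antisymm h3 h1
      rw [Finset.sum_eq_sum_iff_of_le (fun i _ => h i)] at h4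
      exact hsp (funext fun i => (h4 i (Finset.mem_univ i)).symm)
    obtain ⟨i, hi⟩ := h2
    rw [hev, Finset.prod_eq_zero (Finset.mem_univ i), mul_zero]
    exact Finset.prod_eq_zero (Finset.mem_range.2 hi) (by simp)
  · intro h; exact absurd hp.1 h

lemma uni_exists (g M : ℕ) : ∃ C : (Fin g → ℕ) → (Fin g → ℕ) → ℂ,
    (∀ a ∈ degLE g M, ∀ a' ∈ degLE g M,
      ∑ p ∈ degLE g M, C a p * mpow (ncv p) a' = if a = a' then 1 else 0) ∧
    (∀ p ∈ degLE g M, ∀ q ∈ degLE g M,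
      ∑ a ∈ degLE g M, mpow (ncv p) a * C a q = if p = q then 1 else 0) := by
  let V : Matrix (degLE g M) (degLE g M) ℂ := Matrix.of fun p a => mpow (ncv p.1) a.1
  have hV : IsUnit V := by
    rw [← Matrix.vecMul_injective_iff_isUnit]
    rw [← Matrix.coe_vecMulLinear, injective_iff_map_eq_zero]
    intro x hx
    have := uni_inj (M := M) (fun p => if h : p ∈ degLE g M then x ⟨p, h⟩ else 0) (by
      intro a ha
      have h1 := congrFun hx ⟨a, ha⟩
      simp only [Matrix.coe_vecMulLinear, Matrix.vecMul, dotProduct, V, Matrix.of_apply,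
        Pi.zero_apply] at h1
      rw [← Finset.sum_coe_sort]
      simpa using h1)
    funext p
    have h2 := this p.1 p.2
    simpa using h2
  have hdet := (Matrix.isUnit_iff_isUnit_det V).1 hV
  refine ⟨fun a p => if h : a ∈ degLE g M ∧ p ∈ degLE g M then V⁻¹ ⟨a, h.1⟩ ⟨p, h.2⟩ else 0, ?_, ?_⟩
  · intro a ha a' ha'
    have h1 := congrFun (congrFun (Matrix.nonsing_inv_mul V hdet) ⟨a, ha⟩) ⟨a', ha'⟩
    rw [Matrix.mul_apply, Matrix.one_apply] at h1
    rw [← Finset.sum_coe_sort]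
    simpa [ha, V] using h1
  · intro p hp q hq
    have h1 := congrFun (congrFun (Matrix.mul_nonsing_inv V hdet) ⟨p, hp⟩) ⟨q, hq⟩
    rw [Matrix.mul_apply, Matrix.one_apply] at h1
    rw [← Finset.sum_coe_sort]
    simpa [hq, V] using h1

/-- scaled integer point -/
def epv {g : ℕ} (ε : ℝ) (p : Fin g → ℕ) : Fin g → ℂ := fun i => (ε : ℂ) * (p i : ℂ)

lemma mpow_epv {g : ℕ} (ε : ℝ) (p a : Fin g → ℕ) :
    mpow (epv ε p) a = (ε : ℂ) ^ (∑ i, a i) * mpow (ncv p) a := by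
  simp only [mpow, epv, ncv, mul_pow, Finset.prod_mul_distrib, Finset.prod_pow_eq_pow_sum]

lemma norm_mpow_epv_le {g M : ℕ} {ε : ℝ} (hε : 0 ≤ ε) {p : Fin g → ℕ} (hp : p ∈ degLE g M)
    (a : Fin g → ℕ) : ‖mpow (epv ε p) a‖ ≤ (ε * M) ^ (∑ i, a i) := by
  unfold mpow
  rw [norm_prod, ← Finset.prod_pow_eq_pow_sum]
  refine Finset.prod_le_prod (fun _ _ => norm_nonneg _) fun i _ => ?_
  rw [norm_pow]
  refine pow_le_pow_left₀ (norm_nonneg _) ?_ _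
  simp only [epv, norm_mul, Complex.norm_real, Real.norm_eq_abs, abs_of_nonneg hε, Complex.norm_natCast]
  refine mul_le_mul_of_nonneg_left ?_ hε
  exact_mod_cast (Finset.single_le_sum (fun _ _ => Nat.zero_le _) (Finset.mem_univ i)).trans
    (mem_degLE.1 hp)

lemma form_term_le {g M : ℕ} {ε ρ : ℝ} (hε : 0 ≤ ε) (hρ : 0 < ρ) (hερ : ε * M ≤ ρ)
    (c : (Fin g → ℕ) → ℂ) (a : Fin g → ℕ) (s : ℕ) (hs : s ≤ ∑ i, a i) :
    ‖∑ p ∈ degLE g M, c p * mpow (epv ε p) a‖ ^ 2 ≤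
      ρ ^ (2 * ∑ i, a i) * ((∑ p ∈ degLE g M, ‖c p‖) ^ 2 * (ε * M / ρ) ^ (2 * s)) := by
  have ht : 0 ≤ ε * M / ρ := by positivity
  have ht1 : ε * M / ρ ≤ 1 := (div_le_one hρ).2 hερ
  have h1 : ‖∑ p ∈ degLE g M, c p * mpow (epv ε p) a‖ ≤
      (∑ p ∈ degLE g M, ‖c p‖) * (ε * M) ^ (∑ i, a i) := by
    refine (norm_sum_le _ _).trans ?_
    rw [Finset.sum_mul]
    refine Finset.sum_le_sum fun p hp => ?_
    rw [norm_mul]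
    exact mul_le_mul_of_nonneg_left (norm_mpow_epv_le hε hp a) (norm_nonneg _)
  have h2 : ε * M = ρ * (ε * M / ρ) := by field_simp
  calc _ ≤ ((∑ p ∈ degLE g M, ‖c p‖) * (ε * M) ^ (∑ i, a i)) ^ 2 := by gcongr
    _ = ρ ^ (2 * ∑ i, a i) * ((∑ p ∈ degLE g M, ‖c p‖) ^ 2 * (ε * M / ρ) ^ (2 * ∑ i, a i)) := by
        have h3 : (ε * M) ^ (∑ i, a i) = ρ ^ (∑ i, a i) * (ε * M / ρ) ^ (∑ i, a i) := by
          rw [← mul_pow, ← h2]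
        rw [h3, pow_mul', pow_mul']; ring
    _ ≤ _ := by
        gcongr ?_ * (?_ * ?_)
        exact pow_le_pow_of_le_one ht ht1 (by omega)

lemma form_split {g M s : ℕ} {ε ρ : ℝ} (hε : 0 ≤ ε) (hρ : 0 < ρ) (hερ : ε * M ≤ ρ)
    {κ : (Fin g → ℕ) → ℝ} (hκ : Summable fun a : Fin g → ℕ => |κ a| * ρ ^ (2 * ∑ i, a i))
    (c : (Fin g → ℕ) → ℂ) :
    (Summable fun a => κ a * ‖∑ p ∈ degLE g M, c p * mpow (epv ε p) a‖ ^ 2) ∧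
    |(∑' a, κ a * ‖∑ p ∈ degLE g M, c p * mpow (epv ε p) a‖ ^ 2) -
      ∑ a ∈ degLE g s, κ a * ‖∑ p ∈ degLE g M, c p * mpow (epv ε p) a‖ ^ 2| ≤
      (∑' a : Fin g → ℕ, |κ a| * ρ ^ (2 * ∑ i, a i)) *
        ((∑ p ∈ degLE g M, ‖c p‖) ^ 2 * (ε * M / ρ) ^ (2 * (s + 1))) := by
  set S : (Fin g → ℕ) → ℝ := fun a => ‖∑ p ∈ degLE g M, c p * mpow (epv ε p) a‖ ^ 2 with hS
  have hsum : Summable fun a => κ a * S a := by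
    refine Summable.of_norm_bounded (hκ.mul_right ((∑ p ∈ degLE g M, ‖c p‖) ^ 2 * 1)) fun a => ?_
    rw [norm_mul, Real.norm_eq_abs, mul_assoc]
    refine mul_le_mul_of_nonneg_left ?_ (abs_nonneg _)
    have := form_term_le hε hρ hερ c a 0 (Nat.zero_le _)
    rw [Real.norm_eq_abs, abs_of_nonneg (by positivity)]
    simpa using this
  refine ⟨hsum, ?_⟩
  have h1 : HasSum (fun a => if a ∈ degLE g s then κ a * S a else 0)
      (∑ a ∈ degLE g s, κ a * S a) := by
    have : HasSum (fun a => if a ∈ degLE g s then κ a * S a else 0)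
        (∑ a ∈ degLE g s, if a ∈ degLE g s then κ a * S a else 0) :=
      hasSum_sum_of_ne_finset_zero (fun a ha => if_neg ha)
    rwa [Finset.sum_congr rfl (fun a ha => if_pos ha)] at this
  have h2 := hsum.hasSum.sub h1
  rw [← h2.tsum_eq, ← Real.norm_eq_abs]
  refine tsum_of_norm_bounded (hκ.hasSum.mul_right _) fun a => ?_
  by_cases ha : a ∈ degLE g s
  · simp only [ha, if_true, sub_self, norm_zero]
    positivity
  · simp only [ha, if_false, sub_zero]
    rw [norm_mul, Real.norm_eq_abs, mul_assoc]
    refine mul_le_mul_of_nonneg_left ?_ (abs_nonneg _)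
    rw [mem_degLE] at ha
    have := form_term_le hε hρ hερ c a (s + 1) (by omega)
    rw [Real.norm_eq_abs, abs_of_nonneg (by positivity)]
    exact this

lemma low_psd {g M : ℕ} {ρ : ℝ} (hρ : 0 < ρ) {Q : (Fin g → ℕ) → ℝ}
    (hQs : Summable fun a : Fin g → ℕ => |Q a| * ρ ^ (2 * ∑ i, a i))
    (hQ : ∀ a ∈ degLE g M, 0 < Q a) :
    ∃ ε₀ > 0, ∀ ε, 0 < ε → ε < ε₀ → ∀ c : (Fin g → ℕ) → ℂ,
      0 ≤ ∑' a, Q a * ‖∑ p ∈ degLE g M, c p * mpow (epv ε p) a‖ ^ 2 := by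
  obtain ⟨C, -, hC⟩ := uni_exists g M
  obtain ⟨q, hq, hqQ⟩ : ∃ q > 0, ∀ a ∈ degLE g M, q ≤ Q a := by
    have hne : (degLE g M).Nonempty := ⟨0, by simp [mem_degLE]⟩
    obtain ⟨a, ha, hmin⟩ := Finset.exists_min_image _ Q hne
    exact ⟨Q a, hQ a ha, hmin⟩
  set K := ∑' a : Fin g → ℕ, |Q a| * ρ ^ (2 * ∑ i, a i) with hK
  have hK0 : 0 ≤ K := tsum_nonneg fun a => by positivity
  set G := ∑ a ∈ degLE g M, ∑ p ∈ degLE g M, ‖C a p‖ with hG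
  set B := K * (G ^ 2 * (degLE g M).card * (M / ρ) ^ (2 * (M + 1))) with hB
  have hB0 : 0 ≤ B := by positivity
  refine ⟨min 1 (min (ρ / (M + 1)) (q / (B + 1))), by positivity, fun ε hε hε0 c => ?_⟩
  have e1 : ε < 1 := hε0.trans_le (min_le_left _ _)
  have e2 : ε < ρ / (M + 1) := hε0.trans_le ((min_le_right _ _).trans (min_le_left _ _))
  have e3 : ε < q / (B + 1) := hε0.trans_le ((min_le_right _ _).trans (min_le_right _ _))
  rw [lt_div_iff₀ (by positivity)] at e2 e3
  have hερ : ε * M ≤ ρ := by nlinarith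
  obtain ⟨-, hfs⟩ := form_split (s := M) hε.le hρ hερ hQs c
  set x : (Fin g → ℕ) → ℂ := fun a => ∑ p ∈ degLE g M, c p * mpow (ncv p) a with hx
  set X := ∑ a ∈ degLE g M, ‖x a‖ ^ 2 with hX
  have hX0 : 0 ≤ X := by positivity
  have hcx : ∀ p ∈ degLE g M, c p = ∑ a ∈ degLE g M, x a * C a p := by
    intro p hp
    simp only [hx, Finset.sum_mul]
    rw [Finset.sum_comm]
    simp_rw [mul_assoc, ← Finset.mul_sum]
    rw [Finset.sum_congr rfl (fun r hr => by rw [hC r hr p hp])]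
    simp [hp]
  have hc : (∑ p ∈ degLE g M, ‖c p‖) ≤ G * ∑ a ∈ degLE g M, ‖x a‖ := by
    have h1 : ∀ p ∈ degLE g M, ‖c p‖ ≤ ∑ a ∈ degLE g M, ‖x a‖ * ‖C a p‖ := by
      intro p hp
      rw [hcx p hp]
      refine (norm_sum_le _ _).trans (Finset.sum_le_sum fun a _ => (norm_mul_le _ _))
    refine (Finset.sum_le_sum h1).trans ?_
    rw [Finset.sum_comm, Finset.mul_sum]
    refine Finset.sum_le_sum fun a ha => ?_
    rw [← Finset.mul_sum, mul_comm]
    refine mul_le_mul_of_nonneg_right ?_ (norm_nonneg _)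
    exact Finset.single_le_sum (f := fun a => ∑ p ∈ degLE g M, ‖C a p‖)
      (fun _ _ => by positivity) ha
  have hc2 : (∑ p ∈ degLE g M, ‖c p‖) ^ 2 ≤ G ^ 2 * ((degLE g M).card * X) := by
    calc _ ≤ (G * ∑ a ∈ degLE g M, ‖x a‖) ^ 2 := by gcongr
      _ = G ^ 2 * (∑ a ∈ degLE g M, ‖x a‖) ^ 2 := by ring
      _ ≤ _ := by
        refine mul_le_mul_of_nonneg_left ?_ (by positivity)
        exact sq_sum_le_card_mul_sum_sq
  have hlow : q * ε ^ (2 * M) * X ≤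
      ∑ a ∈ degLE g M, Q a * ‖∑ p ∈ degLE g M, c p * mpow (epv ε p) a‖ ^ 2 := by
    rw [hX, Finset.mul_sum]
    refine Finset.sum_le_sum fun a ha => ?_
    have h1 : ∑ p ∈ degLE g M, c p * mpow (epv ε p) a = (ε : ℂ) ^ (∑ i, a i) * x a := by
      simp only [hx, Finset.mul_sum, mpow_epv]
      refine Finset.sum_congr rfl fun p _ => ?_
      ring
    rw [h1, norm_mul, norm_pow, Complex.norm_real, Real.norm_eq_abs, abs_of_pos hε, mul_pow,
      ← mul_assoc]
    refine mul_le_mul_of_nonneg_right ?_ (by positivity)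
    refine mul_le_mul (hqQ a ha) ?_ (by positivity) (hQ a ha).le
    rw [← pow_mul]
    refine pow_le_pow_of_le_one hε.le e1.le ?_
    have := mem_degLE.1 ha
    omega
  have htail : K * ((∑ p ∈ degLE g M, ‖c p‖) ^ 2 * (ε * M / ρ) ^ (2 * (M + 1))) ≤
      B * ε ^ 2 * (ε ^ (2 * M) * X) := by
    calc _ ≤ K * (G ^ 2 * ((degLE g M).card * X) * (ε * M / ρ) ^ (2 * (M + 1))) := by gcongr
      _ = _ := by
        rw [hB, mul_div_assoc, mul_pow]
        ring
  have h3 := (abs_le.1 hfs).1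
  have h4 : B * ε ^ 2 ≤ q := by nlinarith [mul_nonneg hB0 hε.le, mul_nonneg (mul_nonneg hB0 hε.le) (sub_nonneg.2 e1.le)]
  have h5 : B * ε ^ 2 * (ε ^ (2 * M) * X) ≤ q * (ε ^ (2 * M) * X) :=
    mul_le_mul_of_nonneg_right h4 (by positivity)
  linarith

lemma test_bound {g M : ℕ} {ρ : ℝ} (hρ : 0 < ρ) {κ : (Fin g → ℕ) → ℝ}
    (hκ : Summable fun a : Fin g → ℕ => |κ a| * ρ ^ (2 * ∑ i, a i))
    (C : (Fin g → ℕ) → (Fin g → ℕ) → ℂ)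
    (hC : ∀ a ∈ degLE g M, ∀ a' ∈ degLE g M,
      ∑ p ∈ degLE g M, C a p * mpow (ncv p) a' = if a = a' then 1 else 0)
    (b : Fin g → ℕ) (hb : ∑ i, b i = M) :
    ∃ B, 0 ≤ B ∧ ∀ ε, 0 < ε → ε * M ≤ ρ →
      ∑' a, κ a * ‖∑ p ∈ degLE g M, C b p * mpow (epv ε p) a‖ ^ 2 ≤
        ε ^ (2 * M) * (κ b + B * ε ^ 2) := by
  have hbm : b ∈ degLE g M := mem_degLE.2 hb.le
  set K := ∑' a : Fin g → ℕ, |κ a| * ρ ^ (2 * ∑ i, a i) with hK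
  have hK0 : 0 ≤ K := tsum_nonneg fun a => by positivity
  refine ⟨K * ((∑ p ∈ degLE g M, ‖C b p‖) ^ 2 * (M / ρ) ^ (2 * (M + 1))), by positivity,
    fun ε hε hερ => ?_⟩
  obtain ⟨-, hfs⟩ := form_split (s := M) hε.le hρ hερ hκ (C b)
  have h1 := (abs_le.1 hfs).2
  have hlow : ∑ a ∈ degLE g M, κ a * ‖∑ p ∈ degLE g M, C b p * mpow (epv ε p) a‖ ^ 2 =
      ε ^ (2 * M) * κ b := by
    rw [Finset.sum_eq_single b]
    · have : ∑ p ∈ degLE g M, C b p * mpow (epv ε p) b = (ε : ℂ) ^ M := by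
        have h2 := hC b hbm b hbm
        simp only [if_true] at h2
        calc _ = (ε : ℂ) ^ M * ∑ p ∈ degLE g M, C b p * mpow (ncv p) b := by
              rw [Finset.mul_sum]
              refine Finset.sum_congr rfl fun p _ => ?_
              rw [mpow_epv, hb]; ring
          _ = _ := by rw [h2, mul_one]
      rw [this, norm_pow, Complex.norm_real, Real.norm_eq_abs, abs_of_pos hε]
      ring
    · intro a ha hab
      have : ∑ p ∈ degLE g M, C b p * mpow (epv ε p) a = 0 := by
        have h2 := hC b hbm a ha
        rw [if_neg (Ne.symm hab)] at h2
        calc _ = (ε : ℂ) ^ (∑ i, a i) * ∑ p ∈ degLE g M, C b p * mpow (ncv p) a := by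
              rw [Finset.mul_sum]
              refine Finset.sum_congr rfl fun p _ => ?_
              rw [mpow_epv]; ring
          _ = _ := by rw [h2, mul_zero]
      simp [this]
    · intro h; exact absurd hbm h
  rw [hlow] at h1
  have h2 : K * ((∑ p ∈ degLE g M, ‖C b p‖) ^ 2 * (ε * M / ρ) ^ (2 * (M + 1))) =
    ε ^ (2 * M) * (K * ((∑ p ∈ degLE g M, ‖C b p‖) ^ 2 * (M / ρ) ^ (2 * (M + 1))) * ε ^ 2) := by
    rw [mul_div_assoc, mul_pow]; ring
  rw [h2] at h1
  linarith

lemma hbound {g M : ℕ} (C : (Fin g → ℕ) → (Fin g → ℕ) → ℂ)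
    (hC : ∀ p ∈ degLE g (M + 1), ∀ q ∈ degLE g (M + 1),
      ∑ a ∈ degLE g (M + 1), mpow (ncv p) a * C a q = if p = q then 1 else 0) :
    ∃ K, 0 ≤ K ∧ ∀ (h : (Fin g → ℕ) → ℂ) (δ : ℝ), 0 ≤ δ → (∀ p ∈ degLE g M, h p = 0) →
      (∀ b : Fin g → ℕ, ∑ i, b i = M + 1 → ‖∑ p ∈ degLE g (M + 1), C b p * h p‖ ≤ δ) →
      ∀ p ∈ degLE g (M + 1), ‖h p‖ ≤ K * δ := by
  obtain ⟨C', hC', -⟩ := uni_exists g M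
  let T : (degLE g (M + 1) → ℂ) →ₗ[ℂ] (degLE g (M + 1) → ℂ) :=
    LinearMap.pi fun a => if ∑ i, a.1 i = M + 1 then
      ∑ p : degLE g (M + 1), C a.1 p.1 • LinearMap.proj p else LinearMap.proj a
  have hT1 : ∀ h (a : degLE g (M + 1)), ∑ i, a.1 i = M + 1 →
      T h a = ∑ p : degLE g (M + 1), C a.1 p.1 * h p := by
    intro h a ha
    simp [T, ha]
  have hT2 : ∀ h (a : degLE g (M + 1)), ¬ (∑ i, a.1 i = M + 1) → T h a = h a := by
    intro h a ha
    simp [T, ha]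
  have hker : LinearMap.ker T = ⊥ := by
    rw [LinearMap.ker_eq_bot']
    intro h hh
    let y : (Fin g → ℕ) → ℂ := fun a => ∑ p : degLE g (M + 1), C a p.1 * h p
    have hrec : ∀ p : degLE g (M + 1), h p = ∑ a ∈ degLE g (M + 1), mpow (ncv p.1) a * y a := by
      intro p
      simp only [y, Finset.mul_sum]
      rw [Finset.sum_comm]
      simp_rw [← mul_assoc, ← Finset.sum_mul]
      rw [Finset.sum_congr rfl (fun q _ => by rw [hC p.1 p.2 q.1 q.2])]
      simp [Subtype.ext_iff.symm]
    have hytop : ∀ a ∈ degLE g (M + 1), a ∉ degLE g M → y a = 0 := by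
      intro a ha ha'
      have hd : ∑ i, a i = M + 1 := by
        rw [mem_degLE] at ha ha'; omega
      have := hT1 h ⟨a, ha⟩ hd
      rw [hh] at this
      exact this.symm
    have hsub : degLE g M ⊆ degLE g (M + 1) := fun a ha => by
      rw [mem_degLE] at ha ⊢; omega
    have hF : ∀ p ∈ degLE g M, ∑ a ∈ degLE g M, mpow (ncv p) a * y a = 0 := by
      intro p hp
      rw [Finset.sum_subset hsub (fun a ha ha' => by rw [hytop a ha ha', mul_zero])]
      rw [← hrec ⟨p, hsub hp⟩, ← hT2 h ⟨p, hsub hp⟩, hh]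
      · rfl
      · rw [mem_degLE] at hp
        show ¬ (∑ i, p i = M + 1)
        omega
    have hy : ∀ a ∈ degLE g (M + 1), y a = 0 := by
      intro a ha
      by_cases ha' : a ∈ degLE g M
      · have h1 : ∑ p ∈ degLE g M, C' a p * ∑ a' ∈ degLE g M, mpow (ncv p) a' * y a' = 0 :=
          Finset.sum_eq_zero fun p hp => by rw [hF p hp, mul_zero]
        simp only [Finset.mul_sum] at h1
        rw [Finset.sum_comm] at h1
        simp_rw [← mul_assoc, ← Finset.sum_mul] at h1
        rw [Finset.sum_congr rfl (fun q hq => by rw [hC' a ha' q hq])] at h1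
        simpa [ha'] using h1
      · exact hytop a ha ha'
    funext p
    rw [hrec p]
    exact Finset.sum_eq_zero fun a ha => by rw [hy a ha, mul_zero]
  obtain ⟨K, hK, hanti⟩ := T.exists_antilipschitzWith hker
  refine ⟨K, K.2, fun h δ hδ h0 hb p hp => ?_⟩
  have h1 := hanti.le_mul_norm_sub (fun p => h p.1) 0
  have h2 : ‖T (fun p => h p.1)‖ ≤ δ := by
    rw [pi_norm_le_iff_of_nonneg hδ]
    intro a
    by_cases ha : ∑ i, a.1 i = M + 1
    · rw [hT1 _ a ha]
      have := hb a.1 ha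
      rwa [← Finset.sum_coe_sort] at this
    · rw [hT2 _ a ha, h0 a.1 (by have := mem_degLE.1 a.2; rw [mem_degLE]; omega), norm_zero]
      exact hδ
  simp only [map_zero, add_zero, norm_neg, sub_zero] at h1
  refine (norm_le_pi_norm (fun p : degLE g (M + 1) => h p.1) ⟨p, hp⟩).trans (h1.trans ?_)
  exact mul_le_mul_of_nonneg_left h2 K.2

lemma test_ineq {g : ℕ} {Ω : Set (Fin g → ℂ)} {kc ℓc : (Fin g → ℕ) → ℝ} 
    (hk : IsNormalizedDiag Ω kc) (hℓ : IsNormalizedDiag Ω ℓc) {R : Type*} [Fintype R]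
    (φ : Ω → R → ℂ)
    (hφ : IsPosKernel (fun x y : Ω => diagKer ℓc x y - diagKer kc x y *
      ∑ r, φ x r * (starRingEnd ℂ) (φ y r)))
    (s : Finset (Fin g → ℕ)) (z : (Fin g → ℕ) → Ω) (γ : (Fin g → ℕ) → ℂ) (d : R → Fin g → ℕ) :
    ∑ r, kc (d r) * ‖∑ i ∈ s, γ i * φ (z i) r * mpow (z i).1 (d r)‖ ^ 2 ≤
      ∑' a, ℓc a * ‖∑ i ∈ s, γ i * mpow (z i).1 a‖ ^ 2 := by
  have Sk : ∀ x : Ω, SumAt kc x := fun x => sumAt_of_nonneg (fun a => (hk.2.1 a).le) (hk.2.2 x x.2)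
  have Sℓ : ∀ x : Ω, SumAt ℓc x := fun x => sumAt_of_nonneg (fun a => (hℓ.2.1 a).le) (hℓ.2.2 x x.2)
  obtain ⟨sl, hl1, hl2⟩ := diag_form_real (κ := ℓc) (fun i : s => (z i.1).1) (fun i => Sℓ _)
    (fun i => (starRingEnd ℂ) (γ i))
  have hr : ∀ r, ∃ t : ℝ, HasSum (fun a => kc a * ‖∑ i ∈ s, γ i * φ (z i) r * mpow (z i).1 a‖ ^ 2) t ∧
      ∑ i : s, ∑ j : s, γ i * φ (z i) r * (starRingEnd ℂ) (γ j * φ (z j) r) *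
        diagKer kc (z i) (z j) = (t : ℂ) := by
    intro r
    obtain ⟨t, h1, h2⟩ := diag_form_real (κ := kc) (fun i : s => (z i.1).1) (fun i => Sk _)
      (fun i => (starRingEnd ℂ) (γ i * φ (z i) r))
    refine ⟨t, ?_, ?_⟩
    · convert h1 using 5 with a
      rw [← Finset.sum_coe_sort]
      simp only [Complex.conj_conj]
    · simpa only [Complex.conj_conj] using h2
  choose t ht1 ht2 using hr
  have h := isPosKernel_fintype hφ (fun i : s => z i.1) (fun i => (starRingEnd ℂ) (γ i))
  have he : ∑ i : s, ∑ j : s, (starRingEnd ℂ) ((starRingEnd ℂ) (γ i)) * (starRingEnd ℂ) (γ j) *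
      (diagKer ℓc (z i) (z j) - diagKer kc (z i) (z j) *
      ∑ r, φ (z i) r * (starRingEnd ℂ) (φ (z j) r)) = ((sl - ∑ r, t r : ℝ) : ℂ) := by
    push_cast
    rw [← hl2, Finset.sum_congr rfl (fun r _ => (ht2 r).symm),
      Finset.sum_comm (s := (Finset.univ : Finset R)),
      ← Finset.sum_sub_distrib]
    refine Finset.sum_congr rfl fun i _ => ?_
    rw [Finset.sum_comm (s := (Finset.univ : Finset R)), ← Finset.sum_sub_distrib]
    refine Finset.sum_congr rfl fun j _ => ?_
    rw [mul_sub, Finset.mul_sum, Finset.mul_sum]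
    congr 1
    refine Finset.sum_congr rfl fun r _ => ?_
    simp only [map_mul, Complex.conj_conj]
    ring
  rw [he, Complex.zero_le_real] at h
  have hsl : ∑' a, ℓc a * ‖∑ i ∈ s, γ i * mpow (z i).1 a‖ ^ 2 = sl := by
    rw [← hl1.tsum_eq]
    refine tsum_congr fun a => ?_
    rw [← Finset.sum_coe_sort]
    simp only [Complex.conj_conj]
  rw [hsl]
  refine le_trans (Finset.sum_le_sum fun r _ => ?_) (sub_nonneg.1 h)
  exact le_hasSum (ht1 r) (d r) fun a _ => mul_nonneg (hk.2.1 a).le (by positivity)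

lemma cf_one {g M : ℕ} {C : (Fin g → ℕ) → (Fin g → ℕ) → ℂ}
    (hC1 : ∀ a ∈ degLE g (M + 1), ∀ a' ∈ degLE g (M + 1),
      ∑ p ∈ degLE g (M + 1), C a p * mpow (ncv p) a' = if a = a' then 1 else 0)
    {K Λ : ℝ} (hK0 : 0 ≤ K) (hΛ : 0 ≤ Λ)
    (hK : ∀ (h : (Fin g → ℕ) → ℂ) (δ : ℝ), 0 ≤ δ → (∀ p ∈ degLE g M, h p = 0) →
      (∀ b : Fin g → ℕ, ∑ i, b i = M + 1 → ‖∑ p ∈ degLE g (M + 1), C b p * h p‖ ≤ δ) →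
      ∀ p ∈ degLE g (M + 1), ‖h p‖ ≤ K * δ)
    {ε : ℝ} (hε : 0 < ε) (hε1 : ε ≤ 1) {P : ℝ} (hP : 0 ≤ P) {r : Fin g → ℕ} (hr : r ∈ degLE g M)
    (f : (Fin g → ℕ) → ℂ) (hf : ∀ p ∈ degLE g M, f p = (√P : ℂ) * mpow (epv ε p) r)
    (hη : ∀ b : Fin g → ℕ, ∑ i, b i = M + 1 →
      ‖∑ p ∈ degLE g (M + 1), C b p * f p‖ ^ 2 ≤ ε ^ (2 * (M + 1)) * Λ ^ 2)
    (b : Fin g → ℕ) (hb : ∑ i, b i = M + 1) (hrb : r ≤ b) :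
    ε ^ (2 * (M + 1)) * (P - 2 * √P * ((∑ p ∈ degLE g (M + 1), ‖C b p‖) *
      (K * Λ * ((M : ℝ) + 1) ^ (M + 1))) * ε) ≤
      ‖∑ p ∈ degLE g (M + 1), C b p * f p * mpow (epv ε p) (b - r)‖ ^ 2 := by
  set h : (Fin g → ℕ) → ℂ := fun p => f p - (√P : ℂ) * mpow (epv ε p) r with hh
  have hrM := mem_degLE.1 hr
  have hr' : r ∈ degLE g (M + 1) := mem_degLE.2 (by omega)
  have hbm : b ∈ degLE g (M + 1) := mem_degLE.2 hb.le
  have hsum : ∀ b' : Fin g → ℕ, ∑ i, b' i = M + 1 → 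
      ∑ p ∈ degLE g (M + 1), C b' p * h p = ∑ p ∈ degLE g (M + 1), C b' p * f p := by
    intro b' hb'
    have h1 := hC1 b' (mem_degLE.2 hb'.le) r hr'
    rw [if_neg (by rintro rfl; omega)] at h1
    have h2 : ∑ p ∈ degLE g (M + 1), C b' p * ((√P : ℂ) * mpow (epv ε p) r) = 0 := by
      rw [← mul_zero ((√P : ℂ) * (ε : ℂ) ^ (∑ i, r i)), ← h1, Finset.mul_sum]
      refine Finset.sum_congr rfl fun p _ => ?_
      rw [mpow_epv]; ring
    simp only [hh, mul_sub, Finset.sum_sub_distrib, h2, sub_zero]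
  have hbd := hK h (ε ^ (M + 1) * Λ) (by positivity) (fun p hp => by simp [hh, hf p hp])
    (fun b' hb' => by
      rw [hsum b' hb']
      refine le_of_sq_le_sq ?_ (by positivity)
      refine (hη b' hb').trans (le_of_eq ?_)
      rw [pow_mul']; ring)
  set E := ∑ p ∈ degLE g (M + 1), C b p * h p * mpow (epv ε p) (b - r) with hE
  set G := ∑ p ∈ degLE g (M + 1), ‖C b p‖ with hG
  have hdr : (∑ i, (b - r) i) + ∑ i, r i = M + 1 := by
    rw [← hb, ← Finset.sum_add_distrib]
    refine Finset.sum_congr rfl fun i _ => ?_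
    have h5 : r i ≤ b i := hrb i
    simp only [Pi.sub_apply]; omega
  have hEb : ‖E‖ ≤ ε ^ (M + 1) * (G * (K * Λ * ((M : ℝ) + 1) ^ (M + 1)) * ε) := by
    have h1 : ∀ p ∈ degLE g (M + 1), ‖C b p * h p * mpow (epv ε p) (b - r)‖ ≤
        ‖C b p‖ * (K * (ε ^ (M + 1) * Λ) * (ε * ((M : ℝ) + 1) ^ (M + 1))) := by
      intro p hp
      rw [norm_mul, norm_mul, mul_assoc]
      refine mul_le_mul_of_nonneg_left ?_ (norm_nonneg _)
      refine mul_le_mul (hbd p hp) ?_ (norm_nonneg _) (by positivity)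
      refine (norm_mpow_epv_le hε.le hp _).trans ?_
      rw [mul_pow]
      push_cast
      refine mul_le_mul ?_ ?_ (by positivity) hε.le
      · calc _ ≤ ε ^ 1 := pow_le_pow_of_le_one hε.le hε1 (by omega)
          _ = ε := pow_one _
      · exact pow_le_pow_right₀ (by linarith [Nat.cast_nonneg (α := ℝ) M]) (by omega)
    refine (norm_sum_le _ _).trans ((Finset.sum_le_sum h1).trans (le_of_eq ?_))
    rw [← Finset.sum_mul, ← hG]; ring
  have hmain : ∑ p ∈ degLE g (M + 1), C b p * f p * mpow (epv ε p) (b - r) =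
      ((√P * ε ^ (M + 1) : ℝ) : ℂ) + E := by
    have h1 := hC1 b hbm b hbm
    rw [if_pos rfl] at h1
    have h2 : ((√P * ε ^ (M + 1) : ℝ) : ℂ) = 
        ∑ p ∈ degLE g (M + 1), C b p * ((√P : ℂ) * mpow (epv ε p) r) * mpow (epv ε p) (b - r) := by
      rw [← mul_one ((√P * ε ^ (M + 1) : ℝ) : ℂ), ← h1, Finset.mul_sum]
      refine Finset.sum_congr rfl fun p _ => ?_
      have h3 : mpow (epv ε p) r * mpow (epv ε p) (b - r) = (ε : ℂ) ^ (M + 1) * mpow (ncv p) b := by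
        rw [← mpow_add, add_tsub_cancel_of_le hrb, mpow_epv, hb]
      push_cast
      linear_combination (-(C b p) * (√P : ℂ)) * h3
    rw [h2, hE, ← Finset.sum_add_distrib]
    refine Finset.sum_congr rfl fun p _ => ?_
    simp only [hh]; ring
  rw [hmain]
  have hn := norm_sub_le_norm_add ((√P * ε ^ (M + 1) : ℝ) : ℂ) E
  rw [Complex.norm_real, Real.norm_eq_abs, abs_of_nonneg (by positivity)] at hn
  set D := G * (K * Λ * ((M : ℝ) + 1) ^ (M + 1)) with hD
  have hx : 0 ≤ √P * ε ^ (M + 1) := by positivity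
  have key : (√P * ε ^ (M + 1)) ^ 2 - 2 * (√P * ε ^ (M + 1)) * (ε ^ (M + 1) * (D * ε)) ≤
      ‖((√P * ε ^ (M + 1) : ℝ) : ℂ) + E‖ ^ 2 := by
    set x := √P * ε ^ (M + 1)
    have hE0 := norm_nonneg E
    set y := ‖(x : ℂ) + E‖
    have hy : 0 ≤ y := norm_nonneg _
    have h4 : x ^ 2 - 2 * x * ‖E‖ ≤ y ^ 2 := by
      by_cases hc : ‖E‖ ≤ x
      · nlinarith
      · nlinarith
    nlinarith
  refine le_trans (le_of_eq ?_) key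
  rw [mul_pow, Real.sq_sqrt hP]
  ring

lemma exists_rho {g : ℕ} {Ω : Set (Fin g → ℂ)} (hΩo : IsOpen Ω) (h0 : (0 : Fin g → ℂ) ∈ Ω) :
    ∃ ρ : ℝ, 0 < ρ ∧ ∀ z : Fin g → ℂ, (∀ i, ‖z i‖ ≤ ρ) → z ∈ Ω := by
  obtain ⟨r, hr, h⟩ := Metric.isOpen_iff.1 hΩo 0 h0
  refine ⟨r / 2, by positivity, fun z hz => h ?_⟩
  rw [mem_ball_zero_iff]
  exact ((pi_norm_le_iff_of_nonneg (by positivity)).2 hz).trans_lt (by linarith)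

lemma norm_mpow_const {g : ℕ} {ρ : ℝ} (hρ : 0 < ρ) (a : Fin g → ℕ) :
    ‖mpow (fun _ : Fin g => (ρ : ℂ)) a‖ ^ 2 = ρ ^ (2 * ∑ i, a i) := by
  unfold mpow
  rw [Finset.prod_pow_eq_pow_sum, norm_pow, Complex.norm_real, Real.norm_eq_abs, abs_of_pos hρ,
    pow_mul']

lemma sumAt_fin {g M : ℕ} {P : (Fin g → ℕ) → ℝ} (hPs : ∀ a, M < ∑ i, a i → P a = 0)
    (z : Fin g → ℂ) : SumAt P z := by
  refine summable_of_ne_finset_zero (s := degLE g M) fun a ha => ?_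
  rw [mem_degLE, not_le] at ha
  simp [hPs a ha]

lemma diag_fin {g M : ℕ} {P : (Fin g → ℕ) → ℝ} (hP : ∀ a, 0 ≤ P a)
    (hPs : ∀ a, M < ∑ i, a i → P a = 0) (z w : Fin g → ℂ) :
    diagKer P z w = ∑ r : degLE g M, ((√(P r) : ℂ) * mpow z r) *
      (starRingEnd ℂ) ((√(P r) : ℂ) * mpow w r) := by
  unfold diagKer
  rw [tsum_eq_sum (s := degLE g M), ← Finset.sum_coe_sort]
  · refine Finset.sum_congr rfl fun r _ => ?_
    have : (P r : ℂ) = (√(P r) : ℂ) * (√(P r) : ℂ) := by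
      rw [← Complex.ofReal_mul, Real.mul_self_sqrt (hP _)]
    rw [map_mul, Complex.conj_ofReal, this]; ring
  · intro a ha
    rw [mem_degLE, not_le] at ha
    simp [hPs a ha]

lemma cf_strict {g : ℕ} {Ω : Set (Fin g → ℂ)} (hΩo : IsOpen Ω) (h0 : (0 : Fin g → ℂ) ∈ Ω)
    {kc ℓc : (Fin g → ℕ) → ℝ} (hk : IsNormalizedDiag Ω kc) (hℓ : IsNormalizedDiag Ω ℓc)
    (hp : IsCompletePickPair (fun z w : Ω => diagKer kc ↑z ↑w) (fun z w : Ω => diagKer ℓc ↑z ↑w))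
    (M : ℕ) (P : (Fin g → ℕ) → ℝ) (hP : ∀ a, 0 ≤ P a) (hPs : ∀ a, M < ∑ i, a i → P a = 0)
    (hQ : ∀ a ∈ degLE g M, 0 < ℓc a - cconv kc P a)
    (b : Fin g → ℕ) (hb : ∑ i, b i = M + 1) : cconv kc P b ≤ ℓc b := by
  have Sk : ∀ x ∈ Ω, SumAt kc x := fun x hx => sumAt_of_nonneg (fun a => (hk.2.1 a).le) (hk.2.2 x hx)
  have Sℓ : ∀ x ∈ Ω, SumAt ℓc x := fun x hx => sumAt_of_nonneg (fun a => (hℓ.2.1 a).le) (hℓ.2.2 x hx)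
  have SP : ∀ x, SumAt P x := fun x => sumAt_fin hPs x
  have SQ : ∀ x ∈ Ω, SumAt (fun a => ℓc a - cconv kc P a) x := fun x hx =>
    sumAt_sub (Sℓ x hx) (sumAt_cconv (Sk x hx) (SP x))
  have hQd : ∀ x ∈ Ω, ∀ y ∈ Ω, diagKer (fun a => ℓc a - cconv kc P a) x y =
      diagKer ℓc x y - diagKer kc x y * diagKer P x y := by
    intro x hx y hy
    rw [diag_sub (Sℓ x hx) (Sℓ y hy) (sumAt_cconv (Sk x hx) (SP x)) (sumAt_cconv (Sk y hy) (SP y)),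
      diag_mul (Sk x hx) (Sk y hy) (SP x) (SP y)]
  obtain ⟨ρ, hρ, hρΩ⟩ := exists_rho hΩo h0
  have hconst : (fun _ : Fin g => (ρ : ℂ)) ∈ Ω := hρΩ _ fun i => by
    rw [Complex.norm_real, Real.norm_eq_abs, abs_of_pos hρ]
  have rk : ∀ κ : (Fin g → ℕ) → ℝ, SumAt κ (fun _ : Fin g => (ρ : ℂ)) →
      Summable fun a : Fin g → ℕ => |κ a| * ρ ^ (2 * ∑ i, a i) := by
    intro κ h
    unfold SumAt at h
    simpa only [norm_mpow_const hρ] using h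
  obtain ⟨C, hC1, hC2⟩ := uni_exists g (M + 1)
  obtain ⟨K, hK0, hK⟩ := hbound C hC2
  obtain ⟨ε₀, hε₀, hlow⟩ := low_psd hρ (rk _ (SQ _ hconst)) hQ
  have hB : ∀ b' : Fin g → ℕ, ∃ B, 0 ≤ B ∧ (∑ i, b' i = M + 1 → ∀ ε, 0 < ε → ε * ((M + 1 : ℕ) : ℝ) ≤ ρ →
      ∑' a, ℓc a * ‖∑ p ∈ degLE g (M + 1), C b' p * mpow (epv ε p) a‖ ^ 2 ≤
        ε ^ (2 * (M + 1)) * (ℓc b' + B * ε ^ 2)) := by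
    intro b'
    by_cases hb' : ∑ i, b' i = M + 1
    · obtain ⟨B, h1, h2⟩ := test_bound hρ (rk _ (Sℓ _ hconst)) C hC1 b' hb'
      exact ⟨B, h1, fun _ => h2⟩
    · exact ⟨0, le_rfl, fun h => absurd h hb'⟩
  choose B hB0 hBt using hB
  set Λ : ℝ := 1 + ∑ b' ∈ degLE g (M + 1), (ℓc b' + B b') with hΛ
  have hpos' : ∀ b', 0 ≤ ℓc b' + B b' := fun b' => add_nonneg (hℓ.2.1 b').le (hB0 b')
  have hΛ1 : 1 ≤ Λ := by
    have := Finset.sum_nonneg (s := degLE g (M + 1)) fun b' _ => hpos' b'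
    linarith
  have hΛb : ∀ b' : Fin g → ℕ, ∑ i, b' i = M + 1 → ℓc b' + B b' ≤ Λ ^ 2 := by
    intro b' hb'
    have := Finset.single_le_sum (s := degLE g (M + 1)) (fun b' _ => hpos' b') (mem_degLE.2 hb'.le)
    nlinarith
  set D : ℝ := (∑ p ∈ degLE g (M + 1), ‖C b p‖) * (K * Λ * ((M : ℝ) + 1) ^ (M + 1)) with hD
  set ε₁ : ℝ := min (min 1 ε₀) (ρ / ((M + 1 : ℕ) : ℝ)) with hε₁
  have hε₁0 : 0 < ε₁ := by
    have : (0 : ℝ) < ((M + 1 : ℕ) : ℝ) := by positivity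
    simp only [hε₁, lt_min_iff]
    exact ⟨⟨one_pos, hε₀⟩, by positivity⟩
  set S := (degLE g M).filter (fun r => r ≤ b) with hS
  have key : ∀ ε, 0 < ε → ε < ε₁ →
      ∑ r ∈ S, kc (b - r) * (P r - 2 * √(P r) * D * ε) ≤ ℓc b + B b * ε ^ 2 := by
    intro ε hε hεlt
    simp only [hε₁, lt_min_iff] at hεlt
    obtain ⟨⟨he1, he0⟩, heρ⟩ := hεlt
    have hM1 : (0 : ℝ) < ((M + 1 : ℕ) : ℝ) := by positivity
    have heρ' : ε * ((M + 1 : ℕ) : ℝ) ≤ ρ := ((lt_div_iff₀ hM1).1 heρ).le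
    have hmem : ∀ p ∈ degLE g (M + 1), epv ε p ∈ Ω := by
      intro p hp
      refine hρΩ _ fun i => le_trans ?_ heρ'
      simp only [epv, norm_mul, Complex.norm_real, Real.norm_eq_abs, abs_of_pos hε,
        Complex.norm_natCast]
      refine mul_le_mul_of_nonneg_left ?_ hε.le
      exact_mod_cast (Finset.single_le_sum (fun _ _ => Nat.zero_le _) (Finset.mem_univ i)).trans
        (mem_degLE.1 hp)
    have hFF : ∀ p ∈ degLE g M, p ∈ degLE g (M + 1) := fun p hp => by
      rw [mem_degLE] at hp ⊢; omega
    let zz : (Fin g → ℕ) → Ω := fun p => if h : epv ε p ∈ Ω then ⟨epv ε p, h⟩ else ⟨0, h0⟩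
    have hzz : ∀ p ∈ degLE g (M + 1), (zz p).1 = epv ε p := by
      intro p hp
      simp only [zz, dif_pos (hmem p hp)]
    have hne : Nonempty (degLE g M) := ⟨⟨0, by simp [mem_degLE]⟩⟩
    obtain ⟨φ, hφ1, hφ2⟩ := row_pick hp
      (diag_isPosKernel (fun z : Ω => z.1) (fun z => Sℓ z z.2) fun a => (hℓ.2.1 a).le)
      (fun p : degLE g M => zz p.1)
      (fun (p : degLE g M) (r : degLE g M) => (√(P r) : ℂ) * mpow (zz p.1).1 r) (by
        intro c
        obtain ⟨s, hs1, hs2⟩ := diag_form_real (fun p : degLE g M => (zz p.1).1)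
          (fun p => SQ _ (zz p.1).2) c
        have h1 := hlow ε hε he0 (fun p => if h : p ∈ degLE g M then (starRingEnd ℂ) (c ⟨p, h⟩) else 0)
        have h2 : ∑' a, (ℓc a - cconv kc P a) * ‖∑ p ∈ degLE g M,
            (if h : p ∈ degLE g M then (starRingEnd ℂ) (c ⟨p, h⟩) else 0) * mpow (epv ε p) a‖ ^ 2 = s := by
          rw [← hs1.tsum_eq]
          refine tsum_congr fun a => ?_
          rw [← Finset.sum_coe_sort]
          congr 3
          refine Finset.sum_congr rfl fun p _ => ?_
          rw [dif_pos p.2, hzz p.1 (hFF _ p.2)]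
        rw [h2] at h1
        rw [← Complex.zero_le_real, ← hs2] at h1
        refine h1.trans (le_of_eq ?_)
        refine Finset.sum_congr rfl fun p _ => Finset.sum_congr rfl fun q _ => ?_
        rw [hQd _ (zz p.1).2 _ (zz q.1).2, diag_fin hP hPs])
    have hη : ∀ (r : degLE g M) (b' : Fin g → ℕ), ∑ i, b' i = M + 1 →
        ‖∑ p ∈ degLE g (M + 1), C b' p * φ (zz p) r‖ ^ 2 ≤ ε ^ (2 * (M + 1)) * Λ ^ 2 := by
      intro r b' hb'
      have h1 := test_ineq hk hℓ φ hφ2 (degLE g (M + 1)) zz (C b') (fun _ => 0)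
      simp only [hk.1, mpow_zero, mul_one, one_mul] at h1
      have h2 := Finset.single_le_sum (s := Finset.univ) (f := fun r : degLE g M =>
        ‖∑ p ∈ degLE g (M + 1), C b' p * φ (zz p) r‖ ^ 2) (fun _ _ => by positivity) (Finset.mem_univ r)
      have h3 := hBt b' hb' ε hε heρ'
      have h4 : ∑' a, ℓc a * ‖∑ p ∈ degLE g (M + 1), C b' p * mpow (zz p).1 a‖ ^ 2 =
          ∑' a, ℓc a * ‖∑ p ∈ degLE g (M + 1), C b' p * mpow (epv ε p) a‖ ^ 2 := by
        refine tsum_congr fun a => ?_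
        rw [Finset.sum_congr rfl fun p hp => by rw [hzz p hp]]
      rw [h4] at h1
      refine h2.trans (h1.trans (h3.trans ?_))
      refine mul_le_mul_of_nonneg_left (le_trans ?_ (hΛb b' hb')) (by positivity)
      have : ε ^ 2 ≤ 1 := pow_le_one₀ hε.le he1.le
      nlinarith [hB0 b']
    have h1 := test_ineq hk hℓ φ hφ2 (degLE g (M + 1)) zz (C b) (fun r => b - r.1)
    have h3 := hBt b hb ε hε heρ'
    have h4 : ∑' a, ℓc a * ‖∑ p ∈ degLE g (M + 1), C b p * mpow (zz p).1 a‖ ^ 2 =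
        ∑' a, ℓc a * ‖∑ p ∈ degLE g (M + 1), C b p * mpow (epv ε p) a‖ ^ 2 := by
      refine tsum_congr fun a => ?_
      rw [Finset.sum_congr rfl fun p hp => by rw [hzz p hp]]
    rw [h4] at h1
    have h5 : ε ^ (2 * (M + 1)) * ∑ r ∈ S, kc (b - r) * (P r - 2 * √(P r) * D * ε) ≤
        ∑ r : degLE g M, kc (b - r.1) * ‖∑ p ∈ degLE g (M + 1), C b p * φ (zz p) r *
          mpow (zz p).1 (b - r.1)‖ ^ 2 := by
      rw [Finset.mul_sum, hS, Finset.sum_filter, ← Finset.sum_coe_sort]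
      refine Finset.sum_le_sum fun r _ => ?_
      split_ifs with hrb
      · have h6 := cf_one hC1 hK0 (zero_le_one.trans hΛ1) hK hε he1.le (hP r.1) r.2 (fun p => φ (zz p) r)
          (fun p hp => by
            have := congrFun (hφ1 ⟨p, hp⟩) r
            simp only at this
            rw [this, hzz p (hFF p hp)]) (hη r) b hb hrb
        have h7 : ∑ p ∈ degLE g (M + 1), C b p * φ (zz p) r * mpow (zz p).1 (b - r.1) =
            ∑ p ∈ degLE g (M + 1), C b p * φ (zz p) r * mpow (epv ε p) (b - r.1) :=
          Finset.sum_congr rfl fun p hp => by rw [hzz p hp]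
        rw [h7, mul_left_comm]
        exact mul_le_mul_of_nonneg_left h6 (hk.2.1 _).le
      · exact mul_nonneg (hk.2.1 _).le (by positivity)
    exact le_of_mul_le_mul_left (h5.trans (h1.trans h3)) (by positivity)
  have hlim : ∑ r ∈ S, kc (b - r) * P r ≤ ℓc b := by
    have hl : Filter.Tendsto (fun ε : ℝ => ∑ r ∈ S, kc (b - r) * (P r - 2 * √(P r) * D * ε))
        (nhdsWithin 0 (Set.Ioi 0)) (nhds (∑ r ∈ S, kc (b - r) * (P r - 2 * √(P r) * D * 0))) := by
      apply Filter.Tendsto.mono_left _ nhdsWithin_le_nhds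
      exact Continuous.tendsto (by fun_prop) 0
    have hr : Filter.Tendsto (fun ε : ℝ => ℓc b + B b * ε ^ 2)
        (nhdsWithin 0 (Set.Ioi 0)) (nhds (ℓc b + B b * 0 ^ 2)) := by
      apply Filter.Tendsto.mono_left _ nhdsWithin_le_nhds
      exact Continuous.tendsto (by fun_prop) 0
    have := le_of_tendsto_of_tendsto hl hr (by
      filter_upwards [Ioo_mem_nhdsGT hε₁0] with ε hε
      exact key ε hε.1 hε.2)
    simpa using this
  refine le_trans (le_of_eq ?_) hlim
  rw [cconv_comm, cconv_eq_Icc, hS, Finset.sum_filter]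
  rw [← Finset.sum_filter, eq_comm]
  apply Finset.sum_subset_zero_on_sdiff
  · intro r hr
    simp only [Finset.mem_filter] at hr
    simp [hr.2]
  · intro r hr
    simp only [Finset.mem_sdiff, Finset.mem_Icc, Finset.mem_filter, not_and] at hr
    have : r ∉ degLE g M := fun h => hr.2 h hr.1.2
    rw [mem_degLE, not_le] at this
    rw [hPs r this, zero_mul]
  · intro r _
    ring

lemma cf_weak {g : ℕ} {Ω : Set (Fin g → ℂ)} (hΩo : IsOpen Ω) (h0 : (0 : Fin g → ℂ) ∈ Ω)
    {kc ℓc : (Fin g → ℕ) → ℝ} (hk : IsNormalizedDiag Ω kc) (hℓ : IsNormalizedDiag Ω ℓc)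
    (hp : IsCompletePickPair (fun z w : Ω => diagKer kc ↑z ↑w) (fun z w : Ω => diagKer ℓc ↑z ↑w))
    (M : ℕ) (P : (Fin g → ℕ) → ℝ) (hP : ∀ a, 0 ≤ P a) (hPs : ∀ a, M < ∑ i, a i → P a = 0)
    (hQ : ∀ a ∈ degLE g M, 0 ≤ ℓc a - cconv kc P a)
    (b : Fin g → ℕ) (hb : ∑ i, b i = M + 1) : cconv kc P b ≤ ℓc b := by
  have hsc : ∀ δ : ℝ, ∀ a, cconv kc (fun a => (1 - δ) * P a) a = (1 - δ) * cconv kc P a := by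
    intro δ a
    simp only [cconv, Finset.mul_sum]
    exact Finset.sum_congr rfl fun _ _ => by ring
  have h1 : ∀ δ : ℝ, 0 < δ → δ < 1 → (1 - δ) * cconv kc P b ≤ ℓc b := by
    intro δ h1 h2
    rw [← hsc]
    refine cf_strict hΩo h0 hk hℓ hp M _ (fun a => mul_nonneg (by linarith) (hP a))
      (fun a ha => by rw [hPs a ha, mul_zero]) (fun a ha => ?_) b hb
    rw [hsc]
    have := hQ a ha
    nlinarith [hℓ.2.1 a, mul_pos h1 (hℓ.2.1 a), mul_nonneg (sub_nonneg.2 h2.le) this]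
  have hl : Filter.Tendsto (fun δ : ℝ => (1 - δ) * cconv kc P b)
      (nhdsWithin 0 (Set.Ioi 0)) (nhds ((1 - 0) * cconv kc P b)) := by
    apply Filter.Tendsto.mono_left _ nhdsWithin_le_nhds
    exact Continuous.tendsto (by fun_prop) 0
  have := le_of_tendsto hl (by
    filter_upwards [Ioo_mem_nhdsGT one_pos] with δ hδ
    exact h1 δ hδ.1 hδ.2)
  simpa using this

lemma exists_P {g : ℕ} {Ω : Set (Fin g → ℂ)} (hΩo : IsOpen Ω) (h0 : (0 : Fin g → ℂ) ∈ Ω)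
    {kc ℓc : (Fin g → ℕ) → ℝ} (hk : IsNormalizedDiag Ω kc) (hℓ : IsNormalizedDiag Ω ℓc)
    (hp : IsCompletePickPair (fun z w : Ω => diagKer kc ↑z ↑w) (fun z w : Ω => diagKer ℓc ↑z ↑w))
    (A : (Fin g → ℕ) → Prop) (N : ℕ) :
    ∃ P : (Fin g → ℕ) → ℝ, (∀ a, 0 ≤ P a) ∧ (∀ a, N ≤ ∑ i, a i → P a = 0) ∧
      (∀ a, ∑ i, a i < N → (A a → ℓc a - cconv kc P a = 0) ∧ (¬ A a → P a = 0)) ∧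
      (∀ a, ∑ i, a i ≤ N → 0 ≤ ℓc a - cconv kc P a) := by
  induction N with
  | zero =>
    refine ⟨fun _ => 0, fun _ => le_rfl, fun _ _ => rfl, fun a h => absurd h (Nat.not_lt_zero _),
      fun a _ => ?_⟩
    simp only [cconv, mul_zero, Finset.sum_const_zero, sub_zero]
    exact (hℓ.2.1 a).le
  | succ N ih =>
    obtain ⟨P, hP0, hPs, hPA, hQ⟩ := ih
    set P' : (Fin g → ℕ) → ℝ := fun a => if ∑ i, a i = N ∧ A a then ℓc a - cconv kc P a else P a
      with hP'
    have hP'0 : ∀ a, 0 ≤ P' a := by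
      intro a
      simp only [hP']
      split_ifs with h
      · exact hQ a h.1.le
      · exact hP0 a
    have hP's : ∀ a, N < ∑ i, a i → P' a = 0 := by
      intro a ha
      simp only [hP']
      rw [if_neg (by omega), hPs a ha.le]
    have hlow : ∀ a, ∑ i, a i < N → P' a = P a := by
      intro a ha
      simp only [hP']
      rw [if_neg (by omega)]
    have hdeg : ∀ a w : Fin g → ℕ, w ≤ a → w ≠ 0 → ∑ i, (a - w) i < ∑ i, a i := by
      intro a w hw hw0
      have h1 : ∑ i, (a - w) i + ∑ i, w i = ∑ i, a i := by
        rw [← Finset.sum_add_distrib]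
        refine Finset.sum_congr rfl fun i _ => ?_
        have h5 : w i ≤ a i := hw i
        simp only [Pi.sub_apply]; omega
      have h2 : ∑ i, w i ≠ 0 := by
        intro h
        apply hw0
        funext i
        exact (Finset.sum_eq_zero_iff.1 h) i (Finset.mem_univ i)
      omega
    have hcc : ∀ a, ∑ i, a i ≤ N → cconv kc P' a = cconv kc P a + (P' a - P a) := by
      intro a ha
      rw [cconv_eq_Icc, cconv_eq_Icc]
      have hmem : (0 : Fin g → ℕ) ∈ Finset.Icc 0 a := by simp
      rw [← Finset.add_sum_erase _ _ hmem, ← Finset.add_sum_erase _ _ hmem, tsub_zero, hk.1]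
      have : ∑ w ∈ (Finset.Icc 0 a).erase 0, kc w * P' (a - w) =
          ∑ w ∈ (Finset.Icc 0 a).erase 0, kc w * P (a - w) := by
        refine Finset.sum_congr rfl fun w hw => ?_
        rw [Finset.mem_erase, Finset.mem_Icc] at hw
        rw [hlow _ (lt_of_lt_of_le (hdeg a w hw.2.2 hw.1) ha)]
      rw [this]; ring
    have hA' : ∀ a, ∑ i, a i < N + 1 →
        (A a → ℓc a - cconv kc P' a = 0) ∧ (¬ A a → P' a = 0) := by
      intro a ha
      rw [hcc a (by omega)]
      by_cases hN : ∑ i, a i = N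
      · constructor
        · intro h
          have : P' a = ℓc a - cconv kc P a := by simp only [hP']; rw [if_pos ⟨hN, h⟩]
          rw [this, hPs a hN.ge]; ring
        · intro h
          simp only [hP']
          rw [if_neg (fun h' => h h'.2), hPs a hN.ge]
      · have hlt : ∑ i, a i < N := by omega
        rw [hlow a hlt]
        simpa using hPA a hlt
    have hQ' : ∀ a ∈ degLE g N, 0 ≤ ℓc a - cconv kc P' a := by
      intro a ha
      rw [mem_degLE] at ha
      by_cases hA : A a
      · rw [(hA' a (by omega)).1 hA]
      · rw [hcc a ha]
        have h1 := (hA' a (by omega)).2 hA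
        have h2 := hQ a ha
        have h3 := hP0 a
        linarith
    refine ⟨P', hP'0, fun a ha => hP's a (by omega), hA', fun a ha => ?_⟩
    rcases Nat.lt_or_ge N (∑ i, a i) with h | h
    · exact sub_nonneg.2 (cf_weak hΩo h0 hk hℓ hp N P' hP'0 hP's hQ' a (by omega))
    · exact hQ' a (mem_degLE.2 h)

lemma deg_sub_lt {g : ℕ} {a w : Fin g → ℕ} (hw : w ≤ a) (hw0 : w ≠ 0) :
    ∑ i, (a - w) i < ∑ i, a i := by
  have h1 : ∑ i, (a - w) i + ∑ i, w i = ∑ i, a i := by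
    rw [← Finset.sum_add_distrib]
    refine Finset.sum_congr rfl fun i _ => ?_
    have h5 : w i ≤ a i := hw i
    simp only [Pi.sub_apply]; omega
  have h2 : ∑ i, w i ≠ 0 := by
    intro h
    apply hw0
    funext i
    exact (Finset.sum_eq_zero_iff.1 h) i (Finset.mem_univ i)
  omega

lemma g_nonneg {g : ℕ} {Ω : Set (Fin g → ℂ)} (hΩo : IsOpen Ω) (h0 : (0 : Fin g → ℂ) ∈ Ω)
    {kc ℓc : (Fin g → ℕ) → ℝ} (hk : IsNormalizedDiag Ω kc) (hℓ : IsNormalizedDiag Ω ℓc)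
    (hp : IsCompletePickPair (fun z w : Ω => diagKer kc ↑z ↑w) (fun z w : Ω => diagKer ℓc ↑z ↑w))
    {θ : (Fin g → ℕ) → ℝ} (hθ : IsMasterCert kc θ) (b : Fin g → ℕ) :
    0 ≤ ℓc b - cconv θ ℓc b := by
  obtain ⟨P, hP0, hPs, hPA, hQ⟩ := exists_P hΩo h0 hk hℓ hp (fun a => θ (b - a) ≠ 0) (∑ i, b i)
  have h1 : cconv θ (fun a => ℓc a - cconv kc P a) b = 0 := by
    rw [cconv_eq_Icc]
    refine Finset.sum_eq_zero fun w hw => ?_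
    rw [Finset.mem_Icc] at hw
    by_cases hw0 : θ w = 0
    · rw [hw0, zero_mul]
    · have hne : w ≠ 0 := by rintro rfl; exact hw0 hθ.1
      rw [(hPA (b - w) (deg_sub_lt hw.2 hne)).1 (by rwa [tsub_tsub_cancel_of_le hw.2]), mul_zero]
  have h2 : cconv (fun a => cconv θ kc a - kc a + cdel a) P b = 0 := by
    rw [cconv_eq_Icc]
    refine Finset.sum_eq_zero fun w hw => ?_
    rw [Finset.mem_Icc] at hw
    by_cases hw0 : θ w = 0
    · by_cases hne : w = 0
      · rw [hne, tsub_zero, hPs b le_rfl, mul_zero]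
      · rw [(hPA (b - w) (deg_sub_lt hw.2 hne)).2 (by rw [tsub_tsub_cancel_of_le hw.2]; simpa using hw0),
          mul_zero]
    · rw [(cert_f hk.1 hθ w).2 hw0, zero_mul]
  have h3 : cconv θ (fun a => ℓc a - cconv kc P a) b = cconv θ ℓc b - cconv θ (cconv kc P) b := by
    simp only [cconv, mul_sub, Finset.sum_sub_distrib]
  have h4 : cconv (fun a => cconv θ kc a - kc a + cdel a) P b =
      cconv (cconv θ kc) P b - cconv kc P b + cconv cdel P b := by
    rw [cconv_eq_Icc, cconv_eq_Icc (cconv θ kc), cconv_eq_Icc kc, cconv_eq_Icc cdel]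
    simp only [add_mul, sub_mul, Finset.sum_sub_distrib, Finset.sum_add_distrib]
  have h5 : cconv cdel P b = 0 := by
    rw [cconv_eq_Icc]
    refine Finset.sum_eq_zero fun w hw => ?_
    by_cases h : w = 0
    · rw [h, tsub_zero, hPs b le_rfl, mul_zero]
    · simp [cdel, h]
  rw [cconv_assoc] at h4
  have h6 := hQ b le_rfl
  linarith

theorem diag_necessity {g : ℕ} {Ω : Set (Fin g → ℂ)} (hΩo : IsOpen Ω) (h0 : (0 : Fin g → ℂ) ∈ Ω)
    {kc ℓc : (Fin g → ℕ) → ℝ} (hk : IsNormalizedDiag Ω kc) (hℓ : IsNormalizedDiag Ω ℓc)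
    (hp : IsCompletePickPair (fun z w : Ω => diagKer kc ↑z ↑w) (fun z w : Ω => diagKer ℓc ↑z ↑w))
    {θ : (Fin g → ℕ) → ℝ} (hθ : IsMasterCert kc θ) :
    (∀ x ∈ Ω, Summable (fun a : Fin g → ℕ => θ a * ‖mpow x a‖ ^ 2) ∧
          (∑' a : Fin g → ℕ, θ a * ‖mpow x a‖ ^ 2) < 1) ∧
    IsPosKernel (fun z w : Ω => diagKer ℓc ↑z ↑w * (1 - diagKer θ ↑z ↑w)) := by
  have hg := g_nonneg hΩo h0 hk hℓ hp hθ
  have hθ0 := cert_nonneg hk.2.1 hθ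
  have Sℓ : ∀ x ∈ Ω, SumAt ℓc x := fun x hx => sumAt_of_nonneg (fun a => (hℓ.2.1 a).le) (hℓ.2.2 x hx)
  have ha : ∀ x ∈ Ω, Summable (fun a : Fin g → ℕ => θ a * ‖mpow x a‖ ^ 2) ∧
          (∑' a : Fin g → ℕ, θ a * ‖mpow x a‖ ^ 2) < 1 := by
    intro x hx
    set L := ∑' a, ℓc a * ‖mpow x a‖ ^ 2 with hL
    have hL1 : 1 ≤ L := by
      have := (hℓ.2.2 x hx).le_tsum 0 (fun a _ => mul_nonneg (hℓ.2.1 a).le (by positivity))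
      simpa [mpow_zero, hℓ.1] using this
    have hb : ∀ S : Finset (Fin g → ℕ), ∑ a ∈ S, θ a * ‖mpow x a‖ ^ 2 ≤ 1 - 1 / L := by
      intro S
      set θS : (Fin g → ℕ) → ℝ := fun a => if a ∈ S then θ a else 0 with hθS
      have hle : ∀ a, θS a ≤ θ a := fun a => by
        simp only [hθS]; split_ifs
        · exact le_rfl
        · exact hθ0 a
      have hge : ∀ a, 0 ≤ θS a := fun a => by
        simp only [hθS]; split_ifs
        · exact hθ0 a
        · exact le_rfl
      have SS : SumAt θS x := summable_of_ne_finset_zero (s := S) fun a ha => by simp [hθS, ha]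
      have hc : ∀ a, cconv θS ℓc a + cdel a ≤ ℓc a := by
        intro a
        have h1 : cconv θS ℓc a ≤ cconv θ ℓc a := by
          unfold cconv
          exact Finset.sum_le_sum fun p _ => mul_le_mul_of_nonneg_right (hle _) (hℓ.2.1 _).le
        by_cases h : a = 0
        · subst h
          have h2 : cconv θ ℓc 0 = 0 := by
            rw [cconv_eq_Icc]; simp [hθ.1]
          simp only [cdel, if_true, hℓ.1]; linarith
        · have := hg a
          simp only [cdel, h, if_false]; linarith
      have Sc := sumAt_cconv SS (Sℓ x hx)
      have e1 : (∑' a, θS a * ‖mpow x a‖ ^ 2) * L + 1 ≤ L := by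
        have h1 := diag_mul SS SS (Sℓ x hx) (Sℓ x hx)
        have h2 := diag_add Sc Sc (sumAt_cdel x) (sumAt_cdel x)
        rw [diag_cdel, ← h1, diag_diag, diag_diag, diag_diag] at h2
        have h3 : (∑' a, (cconv θS ℓc a + cdel a) * ‖mpow x a‖ ^ 2) =
          (∑' a, θS a * ‖mpow x a‖ ^ 2) * L + 1 := by exact_mod_cast h2
        rw [← h3]
        have hcn : ∀ a, 0 ≤ cconv θS ℓc a + cdel a := fun a => by
          refine add_nonneg ?_ ?_
          · unfold cconv
            exact Finset.sum_nonneg fun p _ => mul_nonneg (hge _) (hℓ.2.1 _).le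
          · unfold cdel; split_ifs <;> norm_num
        have hs := sumAt_add Sc (sumAt_cdel x)
        unfold SumAt at hs
        simp only [abs_of_nonneg (hcn _)] at hs
        exact hs.tsum_le_tsum (fun a => mul_le_mul_of_nonneg_right (hc a) (by positivity)) (hℓ.2.2 x hx)
      have e2 : ∑' a, θS a * ‖mpow x a‖ ^ 2 = ∑ a ∈ S, θ a * ‖mpow x a‖ ^ 2 := by
        rw [tsum_eq_sum (s := S) (fun a ha => by simp [hθS, ha])]
        exact Finset.sum_congr rfl fun a ha => by simp [hθS, ha]
      rw [e2] at e1
      have hLp : 0 < L := by linarith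
      rw [le_sub_iff_add_le, ← mul_le_mul_iff_left₀ hLp, add_mul, one_div_mul_cancel hLp.ne']
      linarith
    have hn : ∀ a, 0 ≤ θ a * ‖mpow x a‖ ^ 2 := fun a => mul_nonneg (hθ0 a) (by positivity)
    refine ⟨summable_of_sum_le hn hb, ?_⟩
    refine (Real.tsum_le_of_sum_le hn hb).trans_lt ?_
    have : 0 < 1 / L := by positivity
    linarith
  refine ⟨ha, ?_⟩
  have Sθ : ∀ x ∈ Ω, SumAt θ x := fun x hx => sumAt_of_nonneg hθ0 (ha x hx).1
  have := diag_isPosKernel (κ := fun a => ℓc a - cconv θ ℓc a) (fun x : Ω => x.1)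
    (fun x => sumAt_sub (Sℓ x x.2) (sumAt_cconv (Sθ x x.2) (Sℓ x x.2))) hg
  convert this using 3 with x y
  rw [diag_sub (Sℓ x x.2) (Sℓ y y.2) (sumAt_cconv (Sθ x x.2) (Sℓ x x.2))
    (sumAt_cconv (Sθ y y.2) (Sℓ y y.2)), ← diag_mul (Sθ x x.2) (Sθ y y.2) (Sℓ x x.2) (Sℓ y y.2)]
  ring

/-- Characterization of complete Pick pairs of normalized diagonal holomorphic kernels:
`(k, ℓ)` on `Ω` is a complete Pick pair iff `Σ_{a ≠ 0} θ_a |x^a|² < 1` on `Ω` (with the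
series convergent) and `ℓ·(1 − Σ_{a ≠ 0} θ_a z^a conj(w^a))` is a positive kernel on `Ω`. -/
theorem diag_completePick_characterization {g : ℕ} (hg : 1 ≤ g)
    (Ω : Set (Fin g → ℂ)) (hΩo : IsOpen Ω) (hΩc : IsConnected Ω)
    (h0 : (0 : Fin g → ℂ) ∈ Ω)
    (kc ℓc : (Fin g → ℕ) → ℝ)
    (hk : IsNormalizedDiag Ω kc) (hℓ : IsNormalizedDiag Ω ℓc)
    (θ : (Fin g → ℕ) → ℝ) (hθ : IsMasterCert kc θ) :
    IsCompletePickPair (fun z w : Ω => diagKer kc ↑z ↑w) (fun z w : Ω => diagKer ℓc ↑z ↑w) ↔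
      ((∀ x ∈ Ω,
          Summable (fun a : Fin g → ℕ => if a = 0 then 0 else θ a * ‖mpow x a‖ ^ 2) ∧
          (∑' a : Fin g → ℕ, if a = 0 then 0 else θ a * ‖mpow x a‖ ^ 2) < 1) ∧
        IsPosKernel (fun z w : Ω =>
          diagKer ℓc ↑z ↑w *
            (1 - ∑' a : Fin g → ℕ,
              if a = 0 then 0 else (θ a : ℂ) * mpow ↑z a * (starRingEnd ℂ) (mpow ↑w a)))) := by
  have e1 : ∀ x : Fin g → ℂ, (fun a : Fin g → ℕ => if a = 0 then 0 else θ a * ‖mpow x a‖ ^ 2) =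
      fun a => θ a * ‖mpow x a‖ ^ 2 := fun x => term_theta hθ.1 x
  simp only [e1, tsum_theta hθ.1]
  constructor
  · intro hp
    exact diag_necessity hΩo h0 hk hℓ hp hθ
  · rintro ⟨ha, hb⟩
    exact diag_sufficiency Ω kc ℓc hk θ hθ ha hb
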